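/- Let d ≥ 4 and let P be a centrally symmetric simplicial d-polytope with g_2(P) = C(d,2) − d. If τ is a missing face of ∂P with 3 ≤ |τ| ≤ d−1, then for every 2-element subset e of τ, the set (τ \ e) ∪ (−e) is a face of ∂P. In particular, the graph of ∂P contains the complete graph on the vertex set τ ∪ (−τ) with the antipodal pairs {v, −v} removed, i.e., every pair {u, w} with u, w ∈ τ ∪ (−τ), u ≠ w, and w ≠ −u is an edge of ∂P. -/

import Mathlib

open Finset
open scoped Classical

noncomputable section

/-- A finite graph: a finite vertex set together with a finite set of edges,
where each edge is (intended to be) a 2-element subset of the vertex set. -/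
structure FinGraph (ι : Type) where
  verts : Finset ι
  edges : Finset (Finset ι)

/-- Every edge is a 2-element subset of the vertex set. -/
def FinGraph.Good {ι : Type} (G : FinGraph ι) : Prop :=
  ∀ e ∈ G.edges, e ⊆ G.verts ∧ e.card = 2

/-- The standard inner (dot) product on `ℝ^d`. -/
def dotR {d : ℕ} (x y : Fin d → ℝ) : ℝ := ∑ i, x i * y i

/-- An infinitesimal motion of the framework `(G, p)`. -/
def IsMotion {ι : Type} {d : ℕ} (G : FinGraph ι) (p m : ι → Fin d → ℝ) : Prop :=
  ∀ e ∈ G.edges, ∀ u ∈ e, ∀ v ∈ e, dotR (p u - p v) (m u - m v) = 0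

/-- The framework `(G, p)` is infinitesimally rigid in `ℝ^d`: every infinitesimal
motion is the restriction of a motion `x ↦ A x + b` of `ℝ^d` with `A` skew-symmetric. -/
def IsInfRigid {ι : Type} (d : ℕ) (G : FinGraph ι) (p : ι → Fin d → ℝ) : Prop :=
  ∀ m : ι → Fin d → ℝ, IsMotion G p m →
    ∃ (A : Matrix (Fin d) (Fin d) ℝ) (b : Fin d → ℝ),
      A.transpose = -A ∧ ∀ v ∈ G.verts, m v = A.mulVec (p v) + b

/-- A stress on the framework `(G, p)`. -/
def IsStress {ι : Type} {d : ℕ} (G : FinGraph ι) (p : ι → Fin d → ℝ)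
    (ω : Finset ι → ℝ) : Prop :=
  ∀ v ∈ G.verts,
    (∑ e ∈ G.edges.filter (fun e => v ∈ e), ∑ u ∈ e.erase v, ω e • (p v - p u)) = 0

/-- A centrally symmetric framework with free involution `ν` satisfying `p (ν v) = -(p v)`. -/
def IsCSFramework {ι : Type} {d : ℕ} (G : FinGraph ι) (p : ι → Fin d → ℝ) (ν : ι → ι) : Prop :=
  (∀ v ∈ G.verts, ν (ν v) = v) ∧
  (∀ v ∈ G.verts, ν v ∈ G.verts) ∧
  (∀ v ∈ G.verts, ν v ≠ v) ∧
  (∀ e ∈ G.edges, e.image ν ∈ G.edges) ∧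
  (∀ e ∈ G.edges, e.image ν ≠ e) ∧
  (∀ v ∈ G.verts, p (ν v) = -(p v))

/-- The convex body spanned by a finite point set. -/
def polyBody {d : ℕ} (V : Finset (Fin d → ℝ)) : Set (Fin d → ℝ) :=
  convexHull ℝ (V : Set (Fin d → ℝ))

/-- `(f, c)` is a supporting functional for `conv V` exposing the face `F`. -/
def IsSupport {d : ℕ} (V : Finset (Fin d → ℝ)) (f : (Fin d → ℝ) →ₗ[ℝ] ℝ) (c : ℝ)
    (F : Set (Fin d → ℝ)) : Prop :=
  (∀ y ∈ polyBody V, f y ≤ c) ∧ F = {y ∈ polyBody V | f y = c}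

/-- A proper face of the polytope `conv V`. -/
def IsProperFace {d : ℕ} (V : Finset (Fin d → ℝ)) (F : Set (Fin d → ℝ)) : Prop :=
  (∃ f c, IsSupport V f c F) ∧ F ≠ polyBody V

/-- A simplicial `d`-polytope in `ℝ^d`, recorded by its vertex set `V`: the polytope is
`conv V`, it is `d`-dimensional, every element of `V` is a vertex, and every proper face
is a simplex (the convex hull of its affinely independent vertex set). -/
structure SPolytope (d : ℕ) where
  V : Finset (Fin d → ℝ)
  span_top : affineSpan ℝ (V : Set (Fin d → ℝ)) = ⊤
  extreme : ∀ v ∈ V, v ∉ convexHull ℝ ((V.erase v : Finset (Fin d → ℝ)) : Set (Fin d → ℝ))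
  simplicial : ∀ F : Set (Fin d → ℝ), IsProperFace V F →
    AffineIndependent ℝ
      (fun x : {y : Fin d → ℝ // y ∈ (V : Set (Fin d → ℝ)) ∩ F} => (x : Fin d → ℝ)) ∧
    F = convexHull ℝ ((V : Set (Fin d → ℝ)) ∩ F)

/-- `s` is a face of the boundary complex `∂P`. -/
def BFace {d : ℕ} (P : SPolytope d) (s : Finset (Fin d → ℝ)) : Prop :=
  s ⊆ P.V ∧ ∃ F : Set (Fin d → ℝ), IsProperFace P.V F ∧ (s : Set (Fin d → ℝ)) ⊆ F

/-- The number of vertices of `∂P`. -/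
def f0 {d : ℕ} (P : SPolytope d) : ℕ := P.V.card

/-- The edges of `∂P`. -/
def edgeFinset {d : ℕ} (P : SPolytope d) : Finset (Finset (Fin d → ℝ)) :=
  P.V.powerset.filter fun e => e.card = 2 ∧ BFace P e

/-- The number of edges of `∂P`. -/
def f1 {d : ℕ} (P : SPolytope d) : ℕ := (edgeFinset P).card

/-- `g₂(P) = f₁ - d f₀ + C(d+1, 2)`. -/
def g2 {d : ℕ} (P : SPolytope d) : ℤ :=
  (f1 P : ℤ) - (d : ℤ) * (f0 P : ℤ) + ((d + 1).choose 2 : ℤ)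

/-- `P` is centrally symmetric. -/
def IsCS {d : ℕ} (P : SPolytope d) : Prop := ∀ v ∈ P.V, -v ∈ P.V

/-- A missing face of `∂P`. -/
def IsMissingFace {d : ℕ} (P : SPolytope d) (σ : Finset (Fin d → ℝ)) : Prop :=
  σ ⊆ P.V ∧ ¬ BFace P σ ∧ ∀ τ ⊂ σ, BFace P τ

/-- `P` is prime: `∂P` has no missing facet, i.e. no missing face of cardinality `d`. -/
def IsPrimePoly {d : ℕ} (P : SPolytope d) : Prop :=
  ¬ ∃ σ : Finset (Fin d → ℝ), IsMissingFace P σ ∧ σ.card = d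

/-- The graph (1-skeleton) of `∂P` as a framework graph. -/
def fullGraph {d : ℕ} (P : SPolytope d) : FinGraph (Fin d → ℝ) :=
  ⟨P.V, edgeFinset P⟩

/-- The graph (1-skeleton) of the star of the face `τ` in `∂P`. -/
def starGraph {d : ℕ} (P : SPolytope d) (τ : Finset (Fin d → ℝ)) : FinGraph (Fin d → ℝ) :=
  ⟨P.V.filter fun v => BFace P (insert v τ),
   P.V.powerset.filter fun e => e.card = 2 ∧ BFace P (e ∪ τ)⟩

/-- Adjacency in the graph of `∂P`. -/
def Adj {d : ℕ} (P : SPolytope d) (u v : Fin d → ℝ) : Prop :=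
  u ≠ v ∧ BFace P {u, v}

/-- `σ` is a face of the link of the face `τ` in `∂P`. -/
def LinkFace {d : ℕ} (P : SPolytope d) (τ σ : Finset (Fin d → ℝ)) : Prop :=
  Disjoint σ τ ∧ BFace P (σ ∪ τ)

/-- `P` is a `d`-dimensional cross-polytope: its vertex set is `{±b₁, …, ±b_d}`
for some basis `b₁, …, b_d` of `ℝ^d`. -/
def IsCrossPolytope {d : ℕ} (P : SPolytope d) : Prop :=
  ∃ b : Fin d → (Fin d → ℝ), LinearIndependent ℝ b ∧
    (P.V : Set (Fin d → ℝ)) = Set.range b ∪ Set.range (fun i => -(b i))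

/-- A facet of `P`: a proper face with `d` vertices. -/
def IsFacet {d : ℕ} (P : SPolytope d) (F : Set (Fin d → ℝ)) : Prop :=
  IsProperFace P.V F ∧ ((P.V : Set (Fin d → ℝ)) ∩ F).ncard = d

/-- `x` lies beyond exactly one facet of `P`: it is strictly separated from `P` by the
affine hull of one facet `F`, and not separated from `P` by the affine hull of any
other facet. -/
def BeyondExactlyOne {d : ℕ} (P : SPolytope d) (x : Fin d → ℝ) : Prop :=
  ∃ F : Set (Fin d → ℝ), IsFacet P F ∧
    (∀ f c, IsSupport P.V f c F → c < f x) ∧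
    (∀ F' : Set (Fin d → ℝ), IsFacet P F' → F' ≠ F →
      ∀ f c, IsSupport P.V f c F' → f x < c)

/-- `P` is obtained from a `d`-dimensional cross-polytope by symmetric stacking: there is
a sequence of cs simplicial `d`-polytopes starting at a cross-polytope and ending at `P`,
each obtained from the previous one as `conv (P_k ∪ {v, -v})` for a point `v` lying
beyond exactly one facet of `P_k`. -/
def SymmetricStackingFrom {d : ℕ} (P : SPolytope d) : Prop :=
  ∃ (m : ℕ) (Q : Fin (m + 1) → SPolytope d),
    (∀ k, IsCS (Q k)) ∧
    IsCrossPolytope (Q 0) ∧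
    Q (Fin.last m) = P ∧
    ∀ k : Fin m, ∃ v : Fin d → ℝ,
      BeyondExactlyOne (Q (Fin.castSucc k)) v ∧
      polyBody (Q (Fin.succ k)).V =
        convexHull ℝ (polyBody (Q (Fin.castSucc k)).V ∪ {v, -v})

/-- `P` is a stacked `d`-polytope: obtained from a `d`-simplex by repeatedly adding a
point beyond exactly one facet. -/
def IsStacked {d : ℕ} (P : SPolytope d) : Prop :=
  ∃ (m : ℕ) (R : Fin (m + 1) → SPolytope d),
    (R 0).V.card = d + 1 ∧
    R (Fin.last m) = P ∧
    ∀ k : Fin m, ∃ v : Fin d → ℝ,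
      BeyondExactlyOne (R (Fin.castSucc k)) v ∧
      polyBody (R (Fin.succ k)).V =
        convexHull ℝ (polyBody (R (Fin.castSucc k)).V ∪ {v})

/-- Every `d` vertices of `P`, no two of which are antipodal, are affinely independent. -/
def GenPos {d : ℕ} (P : SPolytope d) : Prop :=
  ∀ S : Finset (Fin d → ℝ), S ⊆ P.V → S.card = d →
    (∀ x ∈ S, ∀ y ∈ S, x ≠ -y) →
    AffineIndependent ℝ (fun s : {x : Fin d → ℝ // x ∈ S} => (s : Fin d → ℝ))

/-- The graph of the cone `v₀ * S` over a simplicial complex `S` (a set of finsets):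
the vertices of `S` together with `v₀`, and the edges of `S` together with all edges
from `v₀` to vertices of `S`. -/
def coneGraph {d : ℕ} (P : SPolytope d) (v0 : Fin d → ℝ)
    (S : Set (Finset (Fin d → ℝ))) : FinGraph (Fin d → ℝ) :=
  ⟨insert v0 (P.V.filter fun u => ({u} : Finset (Fin d → ℝ)) ∈ S),
   (P.V.powerset.filter fun e => e.card = 2 ∧ e ∈ S) ∪
     (P.V.filter fun u => ({u} : Finset (Fin d → ℝ)) ∈ S).image
       fun u => ({v0, u} : Finset (Fin d → ℝ))⟩

/-- Abstract simplicial cone complex (boundary of a simplicial polytope, homogenised). -/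
structure Cx (U E : Type*) [DecidableEq U] [AddCommGroup E] [Module ℝ E] where
  y : U → E
  o : E
  fs : Finset (Finset U)
  α : Finset U → E →ₗ[ℝ] ℝ
  αo : ∀ F ∈ fs, α F o = 1
  αz : ∀ F ∈ fs, ∀ u ∈ F, α F (y u) = 0
  αp : ∀ F ∈ fs, ∀ F' ∈ fs, ∀ u ∈ F', u ∉ F → 0 < α F (y u)
  ind : ∀ F ∈ fs, LinearIndepOn ℝ y (F : Set U)
  crd : ∀ F ∈ fs, F.card + 1 = Module.finrank ℝ E
  piv : ∀ F ∈ fs, ∀ u ∈ F, ∃ F' ∈ fs, u ∉ F' ∧ F.erase u ⊆ F'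

namespace Cx

variable {U E : Type*} [DecidableEq U] [AddCommGroup E] [Module ℝ E]

lemma αnn (C : Cx U E) {F F' : Finset U} (hF : F ∈ C.fs) (hF' : F' ∈ C.fs) {u : U} (hu : u ∈ F') :
    0 ≤ C.α F (C.y u) := by
  by_cases h : u ∈ F
  · exact (C.αz F hF u h).ge
  · exact (C.αp F hF F' hF' u hu h).le

lemma expand [FiniteDimensional ℝ E] (C : Cx U E) {F : Finset U} (hF : F ∈ C.fs) (z : E) :
    ∃ c : U → ℝ, z = ∑ u ∈ F, c u • C.y u + C.α F z • C.o := by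
  have hspan : Submodule.span ℝ (C.y '' (F : Set U)) = LinearMap.ker (C.α F) := by
    apply Submodule.eq_of_le_of_finrank_eq
    · rw [Submodule.span_le]
      rintro _ ⟨u, hu, rfl⟩
      exact C.αz F hF u hu
    · have h1 : Module.finrank ℝ (Submodule.span ℝ (C.y '' (F : Set U))) = F.card := by
        have h := C.ind F hF
        have := finrank_span_eq_card (R := ℝ) h
        rw [Set.image_eq_range]
        simpa using this
      have h2 := LinearMap.finrank_range_add_finrank_ker (C.α F)
      have h3 : LinearMap.range (C.α F) = ⊤ := by
        rw [LinearMap.range_eq_top]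
        intro t
        exact ⟨t • C.o, by simp [C.αo F hF]⟩
      rw [h3, finrank_top, Module.finrank_self] at h2
      have := C.crd F hF
      omega
  have hz : z - C.α F z • C.o ∈ Submodule.span ℝ (C.y '' (F : Set U)) := by
    rw [hspan, LinearMap.mem_ker]
    simp [C.αo F hF]
  rw [Submodule.mem_span_image_finset_iff_exists_fun] at hz
  obtain ⟨c, hc⟩ := hz
  refine ⟨fun u => if h : u ∈ F then c ⟨u, h⟩ else 0, ?_⟩
  rw [← Finset.sum_coe_sort F]
  simp only [Finset.coe_mem, dite_true, Subtype.coe_eta]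
  rw [hc]; abel

lemma pivf (C : Cx U E) {F F' : Finset U} (hF' : F' ∈ C.fs) {u : U}
    (hu : u ∈ F) (hsub : F.erase u ⊆ F') {z : E} {c : U → ℝ} {t : ℝ}
    (hc : z = ∑ u ∈ F, c u • C.y u + t • C.o) :
    C.α F' z = c u * C.α F' (C.y u) + t := by
  rw [hc, map_add, map_sum, map_smul, C.αo F' hF', ← Finset.add_sum_erase F _ hu,
      Finset.sum_eq_zero (s := F.erase u)]
  · simp
  · intro w hw
    rw [map_smul, C.αz F' hF' w (hsub hw)]; simp

lemma func (C : Cx U E) {F : Finset U} (hF : F ∈ C.fs) (s : U → ℝ) (e : ℝ) :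
    ∃ L : E →ₗ[ℝ] ℝ, (∀ u ∈ F, L (C.y u) = s u) ∧ L C.o = e := by
  have h : LinearIndependent ℝ (fun u : (F : Set U) => C.y u) := C.ind F hF
  obtain ⟨L0, hL0⟩ := LinearMap.exists_extend ((Module.Basis.span h).constr ℝ (fun u => s u))
  have key : ∀ u ∈ F, L0 (C.y u) = s u := by
    intro u hu
    have := (Module.Basis.span h).constr_basis ℝ (fun u : (F : Set U) => s u) ⟨u, hu⟩
    rw [← hL0] at this
    simpa [Module.Basis.span_apply] using this
  refine ⟨L0 + (e - L0 C.o) • C.α F, fun u hu => ?_, ?_⟩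
  · simp [key u hu, C.αz F hF u hu]
  · simp [C.αo F hF]

/-- Facet-connectivity of stars. -/
lemma conn [FiniteDimensional ℝ E] (C : Cx U E) (σ F0 : Finset U) (hF0 : F0 ∈ C.fs) (hs0 : σ ⊆ F0)
    (Q : Finset U → Prop) (h0 : Q F0)
    (hQ : ∀ F ∈ C.fs, ∀ F' ∈ C.fs, σ ⊆ F → σ ⊆ F' → ∀ u ∈ F, u ∉ F' → F.erase u ⊆ F' → Q F → Q F') :
    ∀ F ∈ C.fs, σ ⊆ F → Q F := by
  obtain ⟨z, hz⟩ : ∃ z, z = ∑ w ∈ F0 \ σ, C.y w := ⟨_, rfl⟩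
  by_contra hcon
  push Not at hcon
  obtain ⟨F1, hF1, hs1, hq1⟩ := hcon
  let S := C.fs.filter (fun F => σ ⊆ F ∧ ¬ Q F)
  have hS : S.Nonempty := ⟨F1, by simp [S, hF1, hs1, hq1]⟩
  obtain ⟨F, hFS, hmin⟩ := S.exists_min_image (fun F => C.α F z) hS
  simp only [S, Finset.mem_filter] at hFS
  obtain ⟨hF, hs, hq⟩ := hFS
  obtain ⟨c, hc⟩ := C.expand hF z
  have hne : ¬ (F0 ⊆ F) := by
    intro hsub
    have : F0 = F := Finset.eq_of_subset_of_card_le hsub (by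
      have := C.crd F hF; have := C.crd F0 hF0; omega)
    exact hq (this ▸ h0)
  have hpos : 0 < C.α F z := by
    rw [hz, map_sum]
    apply Finset.sum_pos'
    · intro w hw
      exact C.αnn hF hF0 (Finset.mem_sdiff.1 hw).1
    · rw [Finset.not_subset] at hne
      obtain ⟨w, hw, hw'⟩ := hne
      exact ⟨w, Finset.mem_sdiff.2 ⟨hw, fun h => hw' (hs h)⟩, C.αp F hF F0 hF0 w hw hw'⟩
  have hz0 : C.α F0 z = 0 := by
    rw [hz, map_sum]
    exact Finset.sum_eq_zero fun w hw => C.αz F0 hF0 w (Finset.mem_sdiff.1 hw).1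
  have hex : ∃ u ∈ F, u ∉ σ ∧ c u < 0 := by
    by_contra hno
    push Not at hno
    have h1 := congrArg (C.α F0) hc
    rw [hz0, map_add, map_sum, map_smul, C.αo F0 hF0] at h1
    have : 0 ≤ ∑ u ∈ F, C.α F0 (c u • C.y u) := by
      apply Finset.sum_nonneg
      intro u hu
      rw [map_smul, smul_eq_mul]
      by_cases hus : u ∈ σ
      · rw [C.αz F0 hF0 u (hs0 hus)]; simp
      · exact mul_nonneg (hno u hu hus) (C.αnn hF0 hF hu)
    simp at h1
    simp at this
    linarith
  obtain ⟨u, hu, hus, hcu⟩ := hex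
  obtain ⟨F', hF', hu', hsub⟩ := C.piv F hF u hu
  have hs' : σ ⊆ F' := fun w hw => hsub (Finset.mem_erase.2 ⟨fun h => hus (h ▸ hw), hs hw⟩)
  have hlt : C.α F' z < C.α F z := by
    have h1 := C.pivf hF' hu hsub hc
    have := C.αp F' hF' F hF u hu hu'
    nlinarith
  have hq' : Q F' := by
    by_contra hq'
    have := hmin F' (by simp [S, hF', hs', hq'])
    linarith
  -- the vertex of F' not in F
  have hcard : F'.card = F.card := by
    have := C.crd F hF; have := C.crd F' hF'; omega
  have hne' : ¬ (F' ⊆ F) := by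
    intro h
    have := Finset.eq_of_subset_of_card_le h hcard.ge
    exact hu' (this ▸ hu)
  rw [Finset.not_subset] at hne'
  obtain ⟨w, hw, hwF⟩ := hne'
  have he : F.erase u = F'.erase w := by
    apply Finset.eq_of_subset_of_card_le
    · intro x hx
      refine Finset.mem_erase.2 ⟨?_, hsub hx⟩
      rintro rfl
      exact hwF (Finset.mem_of_mem_erase hx)
    · rw [Finset.card_erase_of_mem hu, Finset.card_erase_of_mem hw, hcard]
  exact hq (hQ F' hF' F hF hs' hs w hw hwF (he ▸ Finset.erase_subset _ _) hq')

end Cx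

/-- Extending compatible skew data on an independent family to a skew form. -/
lemma ext_alt {U E : Type*} [AddCommGroup E] [Module ℝ E] (F : Finset U) (y : U → E)
    (M : U → E →ₗ[ℝ] ℝ) (ξ : U → E →ₗ[ℝ] ℝ)
    (hξ : ∀ i ∈ F, ∀ j ∈ F, ξ i (y j) = if i = j then 1 else 0)
    (hM : ∀ i ∈ F, ∀ j ∈ F, M i (y j) + M j (y i) = 0) :
    ∃ B : E →ₗ[ℝ] E →ₗ[ℝ] ℝ, (∀ x z, B x z + B z x = 0) ∧ ∀ i ∈ F, B (y i) = M i := by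
  refine ⟨∑ i ∈ F, ((ξ i).smulRight (M i) - (M i).smulRight (ξ i)) -
    ∑ i ∈ F, ∑ j ∈ F, (M i (y j)) • (ξ i).smulRight (ξ j), ?_, ?_⟩
  · intro x z
    simp only [LinearMap.sub_apply, LinearMap.sum_apply, LinearMap.smulRight_apply,
      LinearMap.smul_apply, smul_eq_mul]
    have h2 : ∑ i ∈ F, ∑ j ∈ F, M i (y j) * (ξ i z * ξ j x) =
        - ∑ i ∈ F, ∑ j ∈ F, M i (y j) * (ξ i x * ξ j z) := by
      rw [Finset.sum_comm, ← Finset.sum_neg_distrib]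
      refine Finset.sum_congr rfl fun i hi => ?_
      rw [← Finset.sum_neg_distrib]
      refine Finset.sum_congr rfl fun j hj => ?_
      have := hM i hi j hj
      have : M j (y i) = - M i (y j) := by linarith
      rw [this]; ring
    have h1 : ∑ i ∈ F, (ξ i x * M i z - M i x * ξ i z) + ∑ i ∈ F, (ξ i z * M i x - M i z * ξ i x) = 0 := by
      rw [← Finset.sum_add_distrib]
      exact Finset.sum_eq_zero fun i _ => by ring
    linarith
  · intro k hk
    ext z
    simp only [LinearMap.sub_apply, LinearMap.sum_apply, LinearMap.smulRight_apply,
      LinearMap.smul_apply, smul_eq_mul]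
    have h1 : ∑ i ∈ F, ∑ j ∈ F, M i (y j) * (ξ i (y k) * ξ j z) = ∑ j ∈ F, M k (y j) * ξ j z := by
      rw [Finset.sum_eq_single_of_mem k hk]
      · refine Finset.sum_congr rfl fun j hj => ?_
        simp [hξ k hk k hk]
      · intro i hi hik
        refine Finset.sum_eq_zero fun j hj => ?_
        simp [hξ i hi k hk, hik]
    have h2 : ∑ i ∈ F, (ξ i (y k) * M i z - M i (y k) * ξ i z) = M k z - ∑ j ∈ F, M j (y k) * ξ j z := by
      rw [Finset.sum_sub_distrib, Finset.sum_eq_single_of_mem k hk]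
      · simp [hξ k hk k hk]
      · intro i hi hik
        simp [hξ i hi k hk, hik]
    rw [h1, h2]
    have h3 : ∑ j ∈ F, M j (y k) * ξ j z + ∑ j ∈ F, M k (y j) * ξ j z = 0 := by
      rw [← Finset.sum_add_distrib]
      refine Finset.sum_eq_zero fun j hj => ?_
      have := hM k hk j hj
      rw [← add_mul]; rw [add_comm, this]; simp
    linarith

namespace Cx

variable {U E : Type*} [DecidableEq U] [AddCommGroup E] [Module ℝ E]

lemma distinct3 (C : Cx U E) (h4 : Module.finrank ℝ E = 4) {u v w : U}
    (h : ({u, v, w} : Finset U) ∈ C.fs) : u ≠ v ∧ u ≠ w ∧ v ≠ w := by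
  have hc := C.crd _ h
  have hc : ({u, v, w} : Finset U).card = 3 := by omega
  refine ⟨?_, ?_, ?_⟩
  · rintro rfl
    have : ({u, u, w} : Finset U).card ≤ 2 := by simpa using Finset.card_le_two
    omega
  · rintro rfl
    have : ({u, v, u} : Finset U).card ≤ 2 := by
      rw [Finset.insert_comm]; simpa using Finset.card_le_two
    omega
  · rintro rfl
    have : ({u, v, v} : Finset U).card ≤ 2 := by simpa using Finset.card_le_two
    omega

lemma func3 (C : Cx U E) (h4 : Module.finrank ℝ E = 4) {u v w : U}
    (h : ({u, v, w} : Finset U) ∈ C.fs) (a b c e : ℝ) :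
    ∃ L : E →ₗ[ℝ] ℝ, L (C.y u) = a ∧ L (C.y v) = b ∧ L (C.y w) = c ∧ L C.o = e := by
  obtain ⟨h1, h2, h3⟩ := C.distinct3 h4 h
  obtain ⟨L, hL, ho⟩ := C.func h (fun x => if x = u then a else if x = v then b else c) e
  refine ⟨L, ?_, ?_, ?_, ho⟩
  · rw [hL u (by simp)]; simp
  · rw [hL v (by simp)]; simp [h1.symm]
  · rw [hL w (by simp)]; simp [h2.symm, h3.symm]

lemma expand3 [FiniteDimensional ℝ E] (C : Cx U E) (h4 : Module.finrank ℝ E = 4) {u v w : U}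
    (h : ({u, v, w} : Finset U) ∈ C.fs) (z : E) :
    ∃ a b c : ℝ, z = a • C.y u + b • C.y v + c • C.y w + C.α {u, v, w} z • C.o := by
  obtain ⟨h1, h2, h3⟩ := C.distinct3 h4 h
  obtain ⟨c, hc⟩ := C.expand h z
  refine ⟨c u, c v, c w, ?_⟩
  rw [Finset.sum_insert (by simp [h1, h2]), Finset.sum_insert (by simp [h3]),
    Finset.sum_singleton] at hc
  rw [← add_assoc] at hc
  exact hc

lemma li4 (C : Cx U E) (h4 : Module.finrank ℝ E = 4) {u v w : U}
    (h : ({u, v, w} : Finset U) ∈ C.fs) :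
    LinearIndependent ℝ ![C.y u, C.y v, C.y w, C.o] := by
  rw [Fintype.linearIndependent_iff]
  intro g hg
  simp [Fin.sum_univ_four] at hg
  have key : ∀ a b c e : ℝ, g 0 * a + g 1 * b + g 2 * c + g 3 * e = 0 := by
    intro a b c e
    obtain ⟨L, l1, l2, l3, l4⟩ := C.func3 h4 h a b c e
    have := congrArg L hg
    simpa [l1, l2, l3, l4] using this
  intro i
  have k1 := key 1 0 0 0
  have k2 := key 0 1 0 0
  have k3 := key 0 0 1 0
  have k4 := key 0 0 0 1
  fin_cases i <;> simp <;> linarith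

lemma exists_vol [FiniteDimensional ℝ E] (C : Cx U E) (h4 : Module.finrank ℝ E = 4) :
    ∃ D : E → E → E → ℝ, (∀ x y z, D x y z = D y x z) ∧ (∀ x y z, D x y z = D x z y) ∧
      (∀ u v w, ({u, v, w} : Finset U) ∈ C.fs → 0 < D (C.y u) (C.y v) (C.y w)) ∧
      (∀ x y z (a b c e : ℝ), D x y (a • x + b • y + c • z + e • C.o) = |c| * D x y z) := by
  let b := Module.finBasisOfFinrankEq ℝ E h4
  refine ⟨fun x y z => |b.det ![x, y, z, C.o]|, ?_, ?_, ?_, ?_⟩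
  · intro x y z
    have := b.det.map_swap ![x, y, z, C.o] (i := 0) (j := 1) (by decide)
    have h2 : ![x, y, z, C.o] ∘ (Equiv.swap (0 : Fin 4) 1) = ![y, x, z, C.o] := by
      ext i; fin_cases i <;> rfl
    rw [h2] at this
    simp only [this, abs_neg]
  · intro x y z
    have := b.det.map_swap ![x, y, z, C.o] (i := 1) (j := 2) (by decide)
    have h2 : ![x, y, z, C.o] ∘ (Equiv.swap (1 : Fin 4) 2) = ![x, z, y, C.o] := by
      ext i; fin_cases i <;> rfl
    rw [h2] at this
    simp only [this, abs_neg]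
  · intro u v w h
    have li := C.li4 h4 h
    have sp := li.span_eq_top_of_card_eq_finrank' (by simp [h4])
    have := (Module.Basis.is_basis_iff_det b).1 ⟨li, sp⟩
    exact abs_pos.2 this.ne_zero
  · intro x y z a' b' c' e'
    have hup : ∀ t, ![x, y, t, C.o] = Function.update ![x, y, 0, C.o] 2 t := by
      intro t; ext i; fin_cases i <;> rfl
    have h1 : b.det ![x, y, x, C.o] = 0 :=
      b.det.map_eq_zero_of_eq _ (i := 0) (j := 2) rfl (by decide)
    have h2 : b.det ![x, y, y, C.o] = 0 :=
      b.det.map_eq_zero_of_eq _ (i := 1) (j := 2) rfl (by decide)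
    have h3 : b.det ![x, y, C.o, C.o] = 0 :=
      b.det.map_eq_zero_of_eq _ (i := 2) (j := 3) rfl (by decide)
    simp only
    rw [hup, b.det.map_update_add, b.det.map_update_add, b.det.map_update_add,
      b.det.map_update_smul, b.det.map_update_smul, b.det.map_update_smul, b.det.map_update_smul,
      ← hup, ← hup, ← hup, ← hup, h1, h2, h3]
    simp [abs_mul]

/-- third vertex analysis: any two facets through an edge -/
lemma third [FiniteDimensional ℝ E] (C : Cx U E) (h4 : Module.finrank ℝ E = 4) {u v w : U}
    (h : ({u, v, w} : Finset U) ∈ C.fs) :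
    ∃ w', w' ≠ w ∧ ({u, v, w'} : Finset U) ∈ C.fs ∧
      ∀ x, ({u, v, x} : Finset U) ∈ C.fs → x = w ∨ x = w' := by
  obtain ⟨h1, h2, h3⟩ := C.distinct3 h4 h
  obtain ⟨F', hF', hw, hsub⟩ := C.piv _ h w (by simp)
  have hu : u ∈ F' := hsub (by simp [h2])
  have hv : v ∈ F' := hsub (by simp [h3])
  have hcard : F'.card = 3 := by have := C.crd _ hF'; omega
  have hsub2 : ({u, v} : Finset U) ⊆ F' := by
    intro x hx; simp at hx; rcases hx with rfl | rfl <;> assumption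
  have : ∃ w' ∈ F', w' ∉ ({u, v} : Finset U) := by
    by_contra hno
    push Not at hno
    have := Finset.card_le_card (show F' ⊆ {u, v} from hno)
    have := Finset.card_le_two (a := u) (b := v)
    omega
  obtain ⟨w', hw', hn⟩ := this
  have hF'e : F' = {u, v, w'} := by
    symm
    apply Finset.eq_of_subset_of_card_le
    · intro x hx; simp at hx; rcases hx with rfl | rfl | rfl <;> assumption
    · rw [hcard]
      simp at hn
      rw [Finset.card_insert_of_notMem (by simp [h1, Ne.symm hn.1]),
        Finset.card_insert_of_notMem (by simp [Ne.symm hn.2])]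
      simp
  subst hF'e
  have hww : w' ≠ w := by rintro rfl; simp at hw
  refine ⟨w', hww, hF', ?_⟩
  intro x hx
  by_contra hno
  push Not at hno
  obtain ⟨x1, x2, x3⟩ := C.distinct3 h4 hx
  obtain ⟨k1, k2, k3⟩ := C.distinct3 h4 hF'
  obtain ⟨a, b, c, he⟩ := C.expand3 h4 h (C.y x)
  -- w' in terms of w
  obtain ⟨a', b', c', he'⟩ := C.expand3 h4 h (C.y w')
  have p1 : 0 < C.α {u, v, w} (C.y x) := C.αp _ h _ hx x (by simp) (by simp [x2.symm, x3.symm, hno.1])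
  have p2 : 0 < C.α {u, v, w} (C.y w') := C.αp _ h _ hF' w' (by simp) (by simp [k2.symm, k3.symm, hww])
  have p3 : 0 < C.α {u, v, w'} (C.y x) := C.αp _ hF' _ hx x (by simp) (by simp [x2.symm, x3.symm, hno.2])
  have p4 : 0 < C.α {u, v, w'} (C.y w) := C.αp _ hF' _ h w (by simp) (by simp [h2.symm, h3.symm, hww.symm])
  have p5 : 0 < C.α {u, v, x} (C.y w) := C.αp _ hx _ h w (by simp) (by simp [h2.symm, h3.symm, hno.1.symm])
  have p6 : 0 < C.α {u, v, x} (C.y w') := C.αp _ hx _ hF' w' (by simp) (by simp [k2.symm, k3.symm, hno.2.symm])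
  have zz : ∀ F ∈ C.fs, u ∈ F → v ∈ F → ∀ t a b c s : ℝ, ∀ z, z = a • C.y u + b • C.y v + c • C.y w + s • C.o →
      C.α F z = c * C.α F (C.y w) + s := by
    intro F hF hu hv t a b c s z hz
    rw [hz]
    simp [C.αz F hF u hu, C.αz F hF v hv, C.αo F hF]
  have e1 := zz _ hF' (by simp) (by simp) 0 _ _ _ _ _ he
  have e2 := zz _ hF' (by simp) (by simp) 0 _ _ _ _ _ he'
  have e3 := zz _ hx (by simp) (by simp) 0 _ _ _ _ _ he
  have e4 := zz _ hx (by simp) (by simp) 0 _ _ _ _ _ he'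
  rw [C.αz _ hF' w' (by simp)] at e2
  rw [C.αz _ hx x (by simp)] at e3
  generalize C.α {u, v, w} (C.y x) = A1 at *
  generalize C.α {u, v, w} (C.y w') = A2 at *
  generalize C.α {u, v, w'} (C.y x) = A3 at *
  generalize C.α {u, v, w'} (C.y w) = A4 at *
  generalize C.α {u, v, x} (C.y w) = A5 at *
  generalize C.α {u, v, x} (C.y w') = A6 at *
  -- e1 : A3 = c*A4 + A1 ; e2 : 0 = c'*A4 + A2 ; e3 : 0 = c*A5 + A1; e4 : A6 = c'*A5+A2
  -- c = -A1/A5, c' = -A2/A4 ; A6 = A2 (1 - A5/A4) > 0 so A5 < A4 ; A3 = A1(1 - A4/A5) >0 so A4<A5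
  have q1 : A5 * A3 = A1 * (A5 - A4) := by linear_combination A5 * e1 - A4 * e3
  have q2 : A4 * A6 = A2 * (A4 - A5) := by linear_combination A4 * e4 - A5 * e2
  have q3 : 0 < A1 * (A5 - A4) := by rw [← q1]; positivity
  have q4 : 0 < A2 * (A4 - A5) := by rw [← q2]; positivity
  have := (pos_iff_pos_of_mul_pos q3).1 p1
  have := (pos_iff_pos_of_mul_pos q4).1 p2
  linarith

lemma exists_W [FiniteDimensional ℝ E] (C : Cx U E) (h4 : Module.finrank ℝ E = 4)
    (S : Finset U) (hS : ∀ F ∈ C.fs, F ⊆ S) :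
    ∃ W : U → U → U → ℝ, ∃ p c : U → U → ℝ,
      (∀ u v w, W u v w = W v u w) ∧ (∀ u v w, W u v w = W u w v) ∧
      (∀ u v w, ({u, v, w} : Finset U) ∈ C.fs → 0 < W u v w) ∧
      (∀ u v w, ({u, v, w} : Finset U) ∉ C.fs → W u v w = 0) ∧
      (∀ u v w, ({u, v, w} : Finset U) ∈ C.fs → 0 < c u v) ∧
      (∀ u v, ∑ w ∈ S, W u v w • C.y w = p v u • C.y u + p u v • C.y v + c u v • C.o) ∧
      (∀ u v, (∀ w, ({u, v, w} : Finset U) ∉ C.fs) → p u v = 0 ∧ c u v = 0) := by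
  obtain ⟨D, d1, d2, dpos, dlin⟩ := C.exists_vol h4
  let W : U → U → U → ℝ := fun u v w =>
    if ({u, v, w} : Finset U) ∈ C.fs then (D (C.y u) (C.y v) (C.y w))⁻¹ else 0
  have W1 : ∀ u v w, W u v w = W v u w := by
    intro u v w; simp only [W]; rw [Finset.insert_comm, d1]
  have W2 : ∀ u v w, W u v w = W u w v := by
    intro u v w; simp only [W]; rw [Finset.pair_comm, d2]
  have W3 : ∀ u v w, ({u, v, w} : Finset U) ∈ C.fs → 0 < W u v w := by
    intro u v w h; simp only [W, h, if_true]; exact inv_pos.2 (dpos u v w h)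
  have W4 : ∀ u v w, ({u, v, w} : Finset U) ∉ C.fs → W u v w = 0 := by
    intro u v w h; simp only [W, h, if_false]
  have ex : ∀ u v, ∃ P Q R : ℝ, ∑ w ∈ S, W u v w • C.y w = P • C.y u + Q • C.y v + R • C.o ∧
      ((∃ w, ({u, v, w} : Finset U) ∈ C.fs) → 0 < R) ∧
      ((∀ w, ({u, v, w} : Finset U) ∉ C.fs) → P = 0 ∧ Q = 0 ∧ R = 0) := by
    intro u v
    by_cases hw : ∃ w, ({u, v, w} : Finset U) ∈ C.fs
    · obtain ⟨w, hw⟩ := hw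
      obtain ⟨w', hne, hw', huniq⟩ := C.third h4 hw
      have hsum : ∑ x ∈ S, W u v x • C.y x = W u v w • C.y w + W u v w' • C.y w' := by
        rw [← Finset.sum_pair (f := fun x => W u v x • C.y x) hne.symm]
        symm
        apply Finset.sum_subset
        · intro x hx
          simp at hx
          rcases hx with rfl | rfl
          · exact hS _ hw (by simp)
          · exact hS _ hw' (by simp)
        · intro x _ hx
          have : ({u, v, x} : Finset U) ∉ C.fs := by
            intro h
            have := huniq x h
            simp at hx; tauto
          rw [W4 _ _ _ this, zero_smul]
      obtain ⟨a, b, c, he⟩ := C.expand3 h4 hw (C.y w')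
      obtain ⟨h1, h2, h3⟩ := C.distinct3 h4 hw
      obtain ⟨k1, k2, k3⟩ := C.distinct3 h4 hw'
      have p2 : 0 < C.α {u, v, w} (C.y w') := C.αp _ hw _ hw' w' (by simp) (by simp [k2.symm, k3.symm, hne])
      have p4 : 0 < C.α {u, v, w'} (C.y w) := C.αp _ hw' _ hw w (by simp) (by simp [h2.symm, h3.symm, hne.symm])
      have e2 : 0 = c * C.α {u, v, w'} (C.y w) + C.α {u, v, w} (C.y w') := by
        have := congrArg (C.α {u, v, w'}) he
        simpa [C.αz _ hw' w' (by simp), C.αz _ hw' u (by simp), C.αz _ hw' v (by simp), C.αo _ hw'] using this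
      have hcneg : c < 0 := by
        by_contra hc
        push Not at hc
        nlinarith [mul_nonneg hc p4.le]
      have hD : D (C.y u) (C.y v) (C.y w') = -c * D (C.y u) (C.y v) (C.y w) := by
        conv_lhs => rw [he]
        rw [dlin, abs_of_neg hcneg]
      have hW' : W u v w' = (D (C.y u) (C.y v) (C.y w'))⁻¹ := by simp only [W, hw', if_true]
      have hW : W u v w = -c * W u v w' := by
        have := dpos _ _ _ hw
        rw [hW', hD]
        simp only [W, hw, if_true]
        have hc0 : c ≠ 0 := hcneg.ne
        field_simp
      refine ⟨W u v w' * a, W u v w' * b, W u v w' * C.α {u, v, w} (C.y w'), ?_, ?_, ?_⟩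
      · rw [hsum, hW]
        generalize C.α {u, v, w} (C.y w') = t at *
        rw [he]
        module
      · intro _
        exact mul_pos (W3 _ _ _ hw') p2
      · intro h; exact absurd hw (h w)
    · push Not at hw
      refine ⟨0, 0, 0, ?_, ?_, fun _ => ⟨rfl, rfl, rfl⟩⟩
      · simp only [W4 _ _ _ (hw _)]; simp
      · rintro ⟨w, h⟩; exact absurd h (hw w)
  choose P Q R hrel hpos hzero using ex
  have hsym : ∀ u v, Q u v = P v u := by
    intro u v
    by_cases hw : ∃ w, ({u, v, w} : Finset U) ∈ C.fs
    · obtain ⟨w, hw⟩ := hw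
      obtain ⟨L, l1, l2, l3, l4⟩ := C.func3 h4 hw 0 1 0 0
      have r1 := congrArg L (hrel u v)
      have r2 := congrArg L (hrel v u)
      simp only [W1 v u] at r2
      rw [r1] at r2
      simpa [l1, l2, l3, l4] using r2
    · push Not at hw
      rw [(hzero u v hw).2.1, (hzero v u (by intro w; rw [Finset.insert_comm]; exact hw w)).1]
  refine ⟨W, fun u v => Q u v, R, W1, W2, W3, W4, fun u v w h => hpos u v ⟨w, h⟩, ?_, ?_⟩
  · intro u v
    simp only
    rw [hrel u v, hsym v u]
  · intro u v h
    exact ⟨(hzero u v h).2.1, (hzero u v h).2.2⟩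

end Cx

/-- weights on a 4-dimensional complex -/
structure WD {U E : Type*} [DecidableEq U] [AddCommGroup E] [Module ℝ E] (C : Cx U E) where
  S : Finset U
  hS : ∀ F ∈ C.fs, F ⊆ S
  W : U → U → U → ℝ
  p : U → U → ℝ
  c : U → U → ℝ
  W1 : ∀ u v w, W u v w = W v u w
  W2 : ∀ u v w, W u v w = W u w v
  W3 : ∀ u v w, ({u, v, w} : Finset U) ∈ C.fs → 0 < W u v w
  W4 : ∀ u v w, ({u, v, w} : Finset U) ∉ C.fs → W u v w = 0
  cpos : ∀ u v w, ({u, v, w} : Finset U) ∈ C.fs → 0 < c u v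
  rel : ∀ u v, ∑ w ∈ S, W u v w • C.y w = p v u • C.y u + p u v • C.y v + c u v • C.o
  zer : ∀ u v, (∀ w, ({u, v, w} : Finset U) ∉ C.fs) → p u v = 0 ∧ c u v = 0

namespace WD

variable {U E : Type*} [DecidableEq U] [AddCommGroup E] [Module ℝ E] {C : Cx U E}

lemma relf (D : WD C) (L : E →ₗ[ℝ] ℝ) (u v : U) :
    ∑ w ∈ D.S, D.W u v w * L (C.y w) =
      D.p v u * L (C.y u) + D.p u v * L (C.y v) + D.c u v * L C.o := by
  have := congrArg L (D.rel u v)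
  simpa using this

lemma Wnn (D : WD C) (u v w : U) : 0 ≤ D.W u v w := by
  by_cases h : ({u, v, w} : Finset U) ∈ C.fs
  · exact (D.W3 _ _ _ h).le
  · exact (D.W4 _ _ _ h).ge

/-- bending of a function on vertices -/
def N (D : WD C) (r : U → ℝ) (v u : U) : ℝ :=
  D.p u v * r v + D.p v u * r u - ∑ w ∈ D.S, D.W v u w * r w

lemma Nsymm (D : WD C) (r : U → ℝ) (v u : U) : D.N r v u = D.N r u v := by
  simp only [N, D.W1 v u]; ring

lemma Nzero (D : WD C) (r : U → ℝ) (v u : U) (h : ∀ w, ({v, u, w} : Finset U) ∉ C.fs) :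
    D.N r v u = 0 := by
  have h' : ∀ w, ({u, v, w} : Finset U) ∉ C.fs := by
    intro w; rw [Finset.insert_comm]; exact h w
  simp [N, D.W4 _ _ _ (h _), (D.zer _ _ h).1, (D.zer _ _ h').1]

lemma czero (D : WD C) (v u : U) (h : ∀ w, ({v, u, w} : Finset U) ∉ C.fs) : D.c v u = 0 :=
  (D.zer _ _ h).2

lemma cnn (D : WD C) (v u : U) : 0 ≤ D.c v u := by
  by_cases h : ∃ w, ({v, u, w} : Finset U) ∈ C.fs
  · obtain ⟨w, h⟩ := h; exact (D.cpos _ _ _ h).le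
  · push Not at h; exact (D.czero _ _ h).ge

lemma balance (D : WD C) (M : U → E →ₗ[ℝ] ℝ)
    (hM : ∀ F ∈ C.fs, ∀ u ∈ F, ∀ v ∈ F, M u (C.y v) + M v (C.y u) = 0)
    (v : U) (ξ : E →ₗ[ℝ] ℝ) (hξ : ξ (C.y v) = 1) (ℓ : E →ₗ[ℝ] ℝ) (hℓ : ℓ (C.y v) = 0) :
    ∑ u ∈ D.S, D.N (fun u => M u C.o) v u * ℓ (C.y u) = 0 := by
  let Mt : U → E →ₗ[ℝ] ℝ := fun u => M u - (ξ (C.y u) • M v - (M v (C.y u)) • ξ)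
  have hMt : ∀ u x, Mt u x = M u x - (ξ (C.y u) * M v x - M v (C.y u) * ξ x) := by
    intro u x; simp [Mt]
  have anti : ∀ F ∈ C.fs, ∀ u ∈ F, ∀ w ∈ F, Mt u (C.y w) + Mt w (C.y u) = 0 := by
    intro F hF u hu w hw
    rw [hMt, hMt]
    linarith [hM F hF u hu w hw]
  have dbl : ∑ u ∈ D.S, ∑ w ∈ D.S, D.W v u w *
      (Mt u (C.y w) * ℓ C.o - Mt u C.o * ℓ (C.y w) + Mt w C.o * ℓ (C.y u)) = 0 := by
    have hneg : ∑ u ∈ D.S, ∑ w ∈ D.S, D.W v u w *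
      (Mt u (C.y w) * ℓ C.o - Mt u C.o * ℓ (C.y w) + Mt w C.o * ℓ (C.y u)) =
      - ∑ u ∈ D.S, ∑ w ∈ D.S, D.W v u w *
      (Mt u (C.y w) * ℓ C.o - Mt u C.o * ℓ (C.y w) + Mt w C.o * ℓ (C.y u)) := by
      conv_lhs => rw [Finset.sum_comm]
      rw [← Finset.sum_neg_distrib]
      refine Finset.sum_congr rfl fun u _ => ?_
      rw [← Finset.sum_neg_distrib]
      refine Finset.sum_congr rfl fun w _ => ?_
      rw [D.W2 v w u]
      by_cases h : ({v, u, w} : Finset U) ∈ C.fs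
      · have := anti _ h u (by simp) w (by simp)
        have : Mt w (C.y u) = - Mt u (C.y w) := by linarith
        rw [this]; ring
      · rw [D.W4 _ _ _ h]; ring
    linarith
  have inner : ∀ u ∈ D.S, ∑ w ∈ D.S, D.W v u w *
      (Mt u (C.y w) * ℓ C.o - Mt u C.o * ℓ (C.y w) + Mt w C.o * ℓ (C.y u)) =
      - (D.N (fun u => M u C.o) v u * ℓ (C.y u)) := by
    intro u _
    by_cases h : ∃ w, ({v, u, w} : Finset U) ∈ C.fs
    · obtain ⟨w, h⟩ := h
      have e1 := D.relf (Mt u) v u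
      have e2 := D.relf ℓ v u
      have m1 : Mt u (C.y u) = 0 := by
        have := anti _ h u (by simp) u (by simp); linarith
      have m2 : Mt u (C.y v) = 0 := by
        have := anti _ h u (by simp) v (by simp)
        have h0 : Mt v (C.y u) = 0 := by
          rw [hMt, hξ]
          have := hM _ h v (by simp) v (by simp)
          have : M v (C.y v) = 0 := by linarith
          rw [this]; ring
        linarith
      have m3 : Mt v C.o = 0 := by
        rw [hMt, hξ]
        have := hM _ h v (by simp) v (by simp)
        have : M v (C.y v) = 0 := by linarith
        rw [this]; ring
      have e3 : ∑ w ∈ D.S, D.W v u w * Mt w C.o =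
          D.p v u * Mt u C.o - D.N (fun u => M u C.o) v u := by
        have f1 := D.relf ξ v u
        have f2 := D.relf (M v) v u
        have : ∑ w ∈ D.S, D.W v u w * Mt w C.o = ∑ w ∈ D.S, D.W v u w * M w C.o
            - (∑ w ∈ D.S, D.W v u w * ξ (C.y w)) * M v C.o
            + (∑ w ∈ D.S, D.W v u w * M v (C.y w)) * ξ C.o := by
          rw [Finset.sum_mul, Finset.sum_mul, ← Finset.sum_sub_distrib, ← Finset.sum_add_distrib]
          refine Finset.sum_congr rfl fun w _ => ?_
          rw [hMt]; ring
        rw [this, f1, f2, hMt, N, hξ]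
        have := hM _ h v (by simp) v (by simp)
        have : M v (C.y v) = 0 := by linarith
        rw [this]
        ring
      have : ∑ w ∈ D.S, D.W v u w *
          (Mt u (C.y w) * ℓ C.o - Mt u C.o * ℓ (C.y w) + Mt w C.o * ℓ (C.y u)) =
          (∑ w ∈ D.S, D.W v u w * Mt u (C.y w)) * ℓ C.o
          - Mt u C.o * (∑ w ∈ D.S, D.W v u w * ℓ (C.y w))
          + (∑ w ∈ D.S, D.W v u w * Mt w C.o) * ℓ (C.y u) := by
        rw [Finset.sum_mul, Finset.mul_sum, Finset.sum_mul, ← Finset.sum_sub_distrib,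
          ← Finset.sum_add_distrib]
        refine Finset.sum_congr rfl fun w _ => ?_
        ring
      rw [this, e1, e2, e3, m1, m2, hℓ]
      ring
    · push Not at h
      rw [D.Nzero _ _ _ h]
      simp [D.W4 _ _ _ (h _)]
  rw [Finset.sum_congr rfl inner, Finset.sum_neg_distrib] at dbl
  linarith

end WD

namespace Cx

variable {U E : Type*} [DecidableEq U] [AddCommGroup E] [Module ℝ E]

lemma mem_of_α_zero (C : Cx U E) {F F' : Finset U} (hF : F ∈ C.fs) (hF' : F' ∈ C.fs) {u : U}
    (hu : u ∈ F') (h : C.α F (C.y u) ≤ 0) : u ∈ F := by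
  by_contra hn
  linarith [C.αp F hF F' hF' u hu hn]

/-- other two vertices of a facet through `v` -/
lemma facet3 (C : Cx U E) (h4 : Module.finrank ℝ E = 4) {F : Finset U} (hF : F ∈ C.fs) {v : U}
    (hv : v ∈ F) : ∃ b c, F = {v, b, c} := by
  have hc := C.crd _ hF
  have h2 : (F.erase v).card = 2 := by rw [Finset.card_erase_of_mem hv]; omega
  obtain ⟨b, c, -, h⟩ := Finset.card_eq_two.1 h2
  exact ⟨b, c, by rw [← h, Finset.insert_erase hv]⟩

lemma facet_eq (C : Cx U E) {F G : Finset U} (hF : F ∈ C.fs) (hG : G ∈ C.fs) (h : F ⊆ G) :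
    F = G := by
  apply Finset.eq_of_subset_of_card_le h
  have := C.crd _ hF
  have := C.crd _ hG
  omega

lemma geom [FiniteDimensional ℝ E] (C : Cx U E) (h4 : Module.finrank ℝ E = 4) {v a x : U}
    (h : ({v, a, x} : Finset U) ∈ C.fs) :
    ∃ b c : U, ∃ ℓ : E →ₗ[ℝ] ℝ, ({v, b, c} : Finset U) ∈ C.fs ∧ 0 < C.α {v, b, c} (C.y a) ∧
      ℓ (C.y v) = 0 ∧ ℓ (C.y a) = 0 ∧ ℓ C.o = 0 ∧
      (∀ u w, ({v, u, w} : Finset U) ∈ C.fs → ℓ (C.y u) = 0 → u = a ∨ u = b ∨ u = c) ∧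
      (∀ u w, ({v, u, w} : Finset U) ∈ C.fs → ({v, u, w} : Finset U) ≠ {v, b, c} →
        0 ≤ ℓ (C.y u) * ℓ (C.y w)) := by
  obtain ⟨hva, hvx, hax⟩ := C.distinct3 h4 h
  obtain ⟨G, hG, hmax⟩ := Finset.exists_max_image (C.fs.filter (fun F => v ∈ F))
    (fun F => C.α F (C.y a)) ⟨_, Finset.mem_filter.2 ⟨h, by simp⟩⟩
  obtain ⟨hG, hvG⟩ := Finset.mem_filter.1 hG
  have hmax : ∀ F ∈ C.fs, v ∈ F → C.α F (C.y a) ≤ C.α G (C.y a) := fun F hF hv =>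
    hmax F (Finset.mem_filter.2 ⟨hF, hv⟩)
  obtain ⟨b, c, rfl⟩ := C.facet3 h4 hG hvG
  obtain ⟨ℓ, l1, l2, l3, l4⟩ := C.func3 h4 h 0 0 1 0
  have hpos : 0 < C.α {v, b, c} (C.y a) := by
    obtain ⟨F', hF', ha, hsub⟩ := C.piv _ h a (by simp)
    have hv : v ∈ F' := hsub (by simp [hva])
    exact (C.αp F' hF' _ h a (by simp) ha).trans_le (hmax F' hF' hv)
  -- main claim
  have main : ∀ u w, ({v, u, w} : Finset U) ∈ C.fs → ∀ s t : ℝ, 0 < s → 0 ≤ t →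
      s * ℓ (C.y u) + t * ℓ (C.y w) = 0 → (a = u ∨ (a = w ∧ 0 < t)) ∨
        (u ∈ ({v, b, c} : Finset U) ∧ (0 < t → w ∈ ({v, b, c} : Finset U))) := by
    intro u w hF s t hs ht hst
    obtain ⟨m, lam, k, hz⟩ := C.expand3 h4 h (s • C.y u + t • C.y w)
    set n := C.α {v, a, x} (s • C.y u + t • C.y w) with hn
    have hk : k = 0 := by
      have := congrArg ℓ hz
      simp [l1, l2, l3, l4] at this
      linarith
    have hn0 : 0 ≤ n := by
      rw [hn, map_add, map_smul, map_smul]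
      have h1 := C.αnn h hF (u := u) (by simp)
      have h2 := C.αnn h hF (u := w) (by simp)
      simp only [smul_eq_mul]; positivity
    subst hk
    have eF := congrArg (C.α {v, u, w}) hz
    have eG := congrArg (C.α {v, b, c}) hz
    have g1 := C.αnn hG hF (u := u) (by simp)
    have g2 := C.αnn hG hF (u := w) (by simp)
    have g3 := C.αnn hF h (u := a) (by simp)
    have g4 := hmax _ hF (by simp)
    simp [C.αz _ hF, C.αz _ hG, C.αo _ hF, C.αo _ hG] at eF eG
    obtain ⟨L, L1, L2, L3, L4⟩ := C.func3 h4 hF 0 1 0 0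
    have eL := congrArg L hz
    simp [L1, L2, L3, L4] at eL
    rcases lt_trichotomy lam 0 with hl | hl | hl
    · right
      have h1 : lam * C.α {v, b, c} (C.y a) ≤ lam * C.α {v, u, w} (C.y a) :=
        mul_le_mul_of_nonpos_left g4 hl.le
      have h2 : s * C.α {v, b, c} (C.y u) + t * C.α {v, b, c} (C.y w) ≤ 0 := by linarith
      have h3 := mul_nonneg hs.le g1
      have h4 := mul_nonneg ht g2
      refine ⟨C.mem_of_α_zero hG hF (by simp) ?_, fun ht => C.mem_of_α_zero hG hF (by simp) ?_⟩
      · by_contra hc; push Not at hc; have := mul_pos hs hc; linarith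
      · by_contra hc; push Not at hc; have := mul_pos ht hc; linarith
    · subst hl; simp at eL; linarith
    · left
      have h1 := mul_nonneg hl.le g3
      have h2 : C.α {v, u, w} (C.y a) ≤ 0 := by
        by_contra hc; push Not at hc; have := mul_pos hl hc; linarith
      have h3 := C.mem_of_α_zero hF h (by simp) h2
      simp only [Finset.mem_insert, Finset.mem_singleton] at h3
      rcases h3 with h3 | h3 | h3
      · exact absurd h3.symm hva
      · exact Or.inl h3
      · right
        refine ⟨h3, ?_⟩
        subst h3
        rw [L3] at eL; simp at eL; linarith
  refine ⟨b, c, ℓ, hG, hpos, l1, l2, l4, ?_, ?_⟩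
  · intro u w hF hu
    obtain ⟨d1, d2, d3⟩ := C.distinct3 h4 hF
    rcases main u w hF 1 0 one_pos le_rfl (by simp [hu]) with (h1 | h1) | h1
    · exact Or.inl h1.symm
    · exact absurd h1.2 (lt_irrefl _)
    · have := h1.1
      simp only [Finset.mem_insert, Finset.mem_singleton] at this
      rcases this with h | h | h
      · exact absurd h.symm d1
      · exact Or.inr (Or.inl h)
      · exact Or.inr (Or.inr h)
  · intro u w hF hne
    by_contra hneg
    push Not at hneg
    have hu0 : ℓ (C.y u) ≠ 0 := by rintro h; rw [h] at hneg; simp at hneg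
    have hw0 : ℓ (C.y w) ≠ 0 := by rintro h; rw [h] at hneg; simp at hneg
    have key : |ℓ (C.y w)| * ℓ (C.y u) + |ℓ (C.y u)| * ℓ (C.y w) = 0 := by
      rcases mul_neg_iff.1 hneg with ⟨h1, h2⟩ | ⟨h1, h2⟩
      · rw [abs_of_pos h1, abs_of_neg h2]; ring
      · rw [abs_of_neg h1, abs_of_pos h2]; ring
    rcases main u w hF _ _ (abs_pos.2 hw0) (abs_nonneg _) key with (h1 | h1) | h1
    · subst h1; exact hu0 l2
    · rw [h1.1] at l2; exact hw0 l2
    · apply hne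
      apply C.facet_eq hF hG
      intro z hz
      simp only [Finset.mem_insert, Finset.mem_singleton] at hz
      rcases hz with rfl | rfl | rfl
      · simp
      · exact h1.1
      · exact h1.2 (abs_pos.2 hu0)

end Cx

namespace WD

variable {U E : Type*} [DecidableEq U] [AddCommGroup E] [Module ℝ E] {C : Cx U E}

lemma local_pos [FiniteDimensional ℝ E] (D : WD C) (h4 : Module.finrank ℝ E = 4)
    (M : U → E →ₗ[ℝ] ℝ)
    (hM : ∀ F ∈ C.fs, ∀ u ∈ F, ∀ v ∈ F, M u (C.y v) + M v (C.y u) = 0)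
    {v a x : U} (h : ({v, a, x} : Finset U) ∈ C.fs) (η : E →ₗ[ℝ] ℝ) (hη : 0 < η (C.y v)) :
    0 ≤ ∑ u ∈ D.S, D.N (fun u => M u C.o) v u *
      (η (C.y v) * M u C.o - M v C.o * η (C.y u)) ∧
    (∑ u ∈ D.S, D.N (fun u => M u C.o) v u *
      (η (C.y v) * M u C.o - M v C.o * η (C.y u)) = 0 →
      ∀ u, D.N (fun u => M u C.o) v u = 0) := by
  obtain ⟨hva, hvx, hax⟩ := C.distinct3 h4 h
  obtain ⟨b, c, ℓ, hG, hα, lv, la, lo, nb, sgn⟩ := C.geom h4 h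
  obtain ⟨hvb, hvc, hbc⟩ := C.distinct3 h4 hG
  have haG : a ∉ ({v, b, c} : Finset U) := by
    intro ha; rw [C.αz _ hG a ha] at hα; exact lt_irrefl _ hα
  simp only [Finset.mem_insert, Finset.mem_singleton, not_or] at haG
  obtain ⟨-, hab, hac⟩ := haG
  have dual : ∀ s0 s1 s2 s3 : ℝ, ∃ φ : E →ₗ[ℝ] ℝ, φ (C.y v) = s0 ∧ φ (C.y a) = s1 ∧
      φ (C.y b) = s2 ∧ φ (C.y c) = s3 := by
    intro s0 s1 s2 s3
    obtain ⟨L, L1, L2, L3, L4⟩ := C.func3 h4 hG s0 s2 s3 0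
    refine ⟨L + ((s1 - L (C.y a)) / C.α {v, b, c} (C.y a)) • C.α {v, b, c}, ?_, ?_, ?_, ?_⟩
    · simp [L1, C.αz _ hG]
    · simp [hα.ne']
    · simp [L2, C.αz _ hG]
    · simp [L3, C.αz _ hG]
  obtain ⟨ξ, hξ, -⟩ := dual 1 0 0 0
  have bal := D.balance M hM v ξ hξ
  set r : U → ℝ := fun u => M u C.o with hr
  set n : U → ℝ := fun u => D.N r v u with hn
  obtain ⟨L, Lv, La, Lb, Lc⟩ := dual (r v) (r a) (r b) (r c)
  set Lo := L C.o with hLo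
  set g : U → ℝ := fun u => r u - L (C.y u) with hg
  set ζ := C.α {v, a, x} with hζ
  have zo : ζ C.o = 1 := C.αo _ h
  have zv : ζ (C.y v) = 0 := C.αz _ h v (by simp)
  have r1 : ∀ u, ∑ w ∈ D.S, D.W v u w * ℓ (C.y w) = D.p v u * ℓ (C.y u) := by
    intro u; rw [D.relf, lv, lo]; ring
  have r2 : ∀ u, ∑ w ∈ D.S, D.W v u w * ζ (C.y w) = D.p v u * ζ (C.y u) + D.c v u := by
    intro u; rw [D.relf, zv, zo]; ring
  set A : U → ℝ := fun u => D.p v u * g u - ∑ w ∈ D.S, D.W v u w * g w with hA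
  have hAn : ∀ u, n u = A u - D.c v u * Lo := by
    intro u
    have h1 := D.relf L v u
    have h2 : ∑ w ∈ D.S, D.W v u w * g w =
        ∑ w ∈ D.S, D.W v u w * r w - ∑ w ∈ D.S, D.W v u w * L (C.y w) := by
      rw [← Finset.sum_sub_distrib]
      exact Finset.sum_congr rfl fun w _ => by simp only [hg]; ring
    simp only [hA]
    rw [h2, h1, Lv]
    simp only [hn, N, hg]
    ring
  -- sums
  have s5 : ∑ u ∈ D.S, A u * ζ (C.y u) = - ∑ u ∈ D.S, D.c v u * g u := by
    have h1 : ∑ u ∈ D.S, (∑ w ∈ D.S, D.W v u w * g w) * ζ (C.y u) =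
        ∑ u ∈ D.S, (D.p v u * ζ (C.y u) + D.c v u) * g u := by
      simp_rw [← r2, Finset.sum_mul]
      rw [Finset.sum_comm]
      refine Finset.sum_congr rfl fun u _ => Finset.sum_congr rfl fun w _ => ?_
      rw [D.W2 v w u]; ring
    simp only [hA, sub_mul, Finset.sum_sub_distrib]
    rw [h1]
    simp only [add_mul, Finset.sum_add_distrib]
    have h2 : ∑ u ∈ D.S, D.p v u * g u * ζ (C.y u) = ∑ u ∈ D.S, D.p v u * ζ (C.y u) * g u :=
      Finset.sum_congr rfl fun u _ => by ring
    rw [h2]; ring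
  have s6 : Lo * ∑ u ∈ D.S, D.c v u * ζ (C.y u) = - ∑ u ∈ D.S, D.c v u * g u := by
    have h1 := bal ζ zv
    have h2 : ∑ u ∈ D.S, n u * ζ (C.y u) =
        ∑ u ∈ D.S, A u * ζ (C.y u) - Lo * ∑ u ∈ D.S, D.c v u * ζ (C.y u) := by
      rw [Finset.mul_sum, ← Finset.sum_sub_distrib]
      exact Finset.sum_congr rfl fun u _ => by rw [hAn]; ring
    have h3 : ∑ u ∈ D.S, n u * ζ (C.y u) = 0 := h1
    linarith
  have s7 : ∑ u ∈ D.S, n u * g u =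
      ∑ u ∈ D.S, A u * g u + Lo ^ 2 * ∑ u ∈ D.S, D.c v u * ζ (C.y u) := by
    have h2 : ∑ u ∈ D.S, n u * g u =
        ∑ u ∈ D.S, A u * g u - Lo * ∑ u ∈ D.S, D.c v u * g u := by
      rw [Finset.mul_sum, ← Finset.sum_sub_distrib]
      exact Finset.sum_congr rfl fun u _ => by rw [hAn]; ring
    rw [h2, pow_two, mul_assoc, s6]; ring
  have ga : g a = 0 := by simp only [hg]; rw [La]; ring
  have gb : g b = 0 := by simp only [hg]; rw [Lb]; ring
  have gc : g c = 0 := by simp only [hg]; rw [Lc]; ring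
  set q : U → ℝ := fun u => g u / ℓ (C.y u) with hq
  have hgq : ∀ u w, ({v, u, w} : Finset U) ∈ C.fs → g u = q u * ℓ (C.y u) := by
    intro u w hF
    by_cases h0 : ℓ (C.y u) = 0
    · rcases nb u w hF h0 with rfl | rfl | rfl <;> simp [h0, ga, gb, gc]
    · simp only [hq]; field_simp
  have pz : ∀ u, (∀ w, ({v, u, w} : Finset U) ∉ C.fs) → D.p v u = 0 := fun u hu => (D.zer v u hu).1
  have hAq : ∀ u, A u = ∑ w ∈ D.S, D.W v u w * (q u - q w) * ℓ (C.y w) := by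
    intro u
    have h1 : ∑ w ∈ D.S, D.W v u w * (q u - q w) * ℓ (C.y w) =
      q u * ∑ w ∈ D.S, D.W v u w * ℓ (C.y w) - ∑ w ∈ D.S, D.W v u w * g w := by
      rw [Finset.mul_sum, ← Finset.sum_sub_distrib]
      refine Finset.sum_congr rfl fun w _ => ?_
      by_cases hF : ({v, u, w} : Finset U) ∈ C.fs
      · rw [hgq w u (by rw [show ({v, w, u} : Finset U) = {v, u, w} by
          rw [Finset.pair_comm]]; exact hF)]; ring
      · rw [D.W4 _ _ _ hF]; ring
    rw [h1, r1]
    simp only [hA]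
    by_cases hu : ∃ w, ({v, u, w} : Finset U) ∈ C.fs
    · obtain ⟨w, hw⟩ := hu
      rw [hgq u w hw]; ring
    · push Not at hu
      rw [pz u hu]; ring
  have hT : ∀ u w, 0 ≤ D.W v u w * (q u - q w) ^ 2 * (ℓ (C.y u) * ℓ (C.y w)) := by
    intro u w
    by_cases hF : ({v, u, w} : Finset U) ∈ C.fs
    · by_cases hFG : ({v, u, w} : Finset U) = {v, b, c}
      · obtain ⟨e1, e2, e3⟩ := C.distinct3 h4 hF
        have hu : u ∈ ({v, b, c} : Finset U) := hFG ▸ (by simp)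
        have hw : w ∈ ({v, b, c} : Finset U) := hFG ▸ (by simp)
        simp only [Finset.mem_insert, Finset.mem_singleton] at hu hw
        have qu : q u = 0 := by
          rcases hu with hu | hu | hu
          · exact absurd hu.symm e1
          · simp [hq, hu, gb]
          · simp [hq, hu, gc]
        have qw : q w = 0 := by
          rcases hw with hu | hu | hu
          · exact absurd hu.symm e2
          · simp [hq, hu, gb]
          · simp [hq, hu, gc]
        simp [qu, qw]
      · have := sgn u w hF hFG
        have := D.Wnn v u w
        positivity
    · rw [D.W4 _ _ _ hF]; simp
  have s8 : 2 * ∑ u ∈ D.S, A u * g u =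
      ∑ u ∈ D.S, ∑ w ∈ D.S, D.W v u w * (q u - q w) ^ 2 * (ℓ (C.y u) * ℓ (C.y w)) := by
    have h1 : ∑ u ∈ D.S, A u * g u = ∑ u ∈ D.S, ∑ w ∈ D.S,
        D.W v u w * (q u - q w) * q u * (ℓ (C.y u) * ℓ (C.y w)) := by
      refine Finset.sum_congr rfl fun u _ => ?_
      by_cases hu : ∃ w, ({v, u, w} : Finset U) ∈ C.fs
      · obtain ⟨w, hw⟩ := hu
        rw [hgq u w hw, hAq, Finset.sum_mul]
        exact Finset.sum_congr rfl fun w _ => by ring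
      · push Not at hu
        rw [hAq]
        simp [D.W4 _ _ _ (hu _)]
    have h2 : ∑ u ∈ D.S, A u * g u = ∑ u ∈ D.S, ∑ w ∈ D.S,
        D.W v u w * (q w - q u) * q w * (ℓ (C.y u) * ℓ (C.y w)) := by
      rw [h1, Finset.sum_comm]
      refine Finset.sum_congr rfl fun u _ => Finset.sum_congr rfl fun w _ => ?_
      rw [D.W2 v w u]; ring
    rw [two_mul]
    nth_rewrite 1 [h1]
    rw [h2, ← Finset.sum_add_distrib]
    refine Finset.sum_congr rfl fun u _ => ?_
    rw [← Finset.sum_add_distrib]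
    exact Finset.sum_congr rfl fun w _ => by ring
  have zcn : ∀ u ∈ D.S, 0 ≤ D.c v u * ζ (C.y u) := by
    intro u _
    by_cases hu : ∃ w, ({v, u, w} : Finset U) ∈ C.fs
    · obtain ⟨w, hw⟩ := hu
      exact mul_nonneg (D.cnn v u) (C.αnn h hw (by simp))
    · push Not at hu
      rw [D.czero _ _ hu]; simp
  have s9 : 0 < ∑ u ∈ D.S, D.c v u * ζ (C.y u) := by
    have hxa : ({v, x, a} : Finset U) ∈ C.fs := by
      rw [show ({v, x, a} : Finset U) = {v, a, x} by rw [Finset.pair_comm]]; exact h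
    obtain ⟨w', hw', hF', -⟩ := C.third h4 hxa
    obtain ⟨e1, e2, e3⟩ := C.distinct3 h4 hF'
    have hF'' : ({v, w', x} : Finset U) ∈ C.fs := by
      rw [show ({v, w', x} : Finset U) = {v, x, w'} by rw [Finset.pair_comm]]; exact hF'
    refine Finset.sum_pos' zcn ⟨w', D.hS _ hF' (by simp), ?_⟩
    refine mul_pos (D.cpos _ _ _ hF'') (C.αp _ h _ hF' w' (by simp) ?_)
    simp [e2.symm, hw', e3.symm]
  have hAg : 0 ≤ ∑ u ∈ D.S, A u * g u := by
    have : 0 ≤ 2 * ∑ u ∈ D.S, A u * g u := by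
      rw [s8]; exact Finset.sum_nonneg fun u _ => Finset.sum_nonneg fun w _ => hT u w
    linarith
  have sE : ∑ u ∈ D.S, n u * (η (C.y v) * r u - r v * η (C.y u)) =
      η (C.y v) * ∑ u ∈ D.S, n u * g u := by
    have h1 := bal (η (C.y v) • L - r v • η) (by simp [Lv]; ring)
    have h2 : ∑ u ∈ D.S, n u * ((η (C.y v) • L - r v • η) (C.y u)) = 0 := h1
    rw [← sub_eq_zero, Finset.mul_sum, ← Finset.sum_sub_distrib, ← h2]
    refine Finset.sum_congr rfl fun u _ => ?_
    simp [hg]; ring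
  have goal1 : ∑ u ∈ D.S, D.N r v u * (η (C.y v) * M u C.o - M v C.o * η (C.y u)) =
      η (C.y v) * ∑ u ∈ D.S, n u * g u := sE
  have hsq : 0 ≤ Lo ^ 2 * ∑ u ∈ D.S, D.c v u * ζ (C.y u) := mul_nonneg (sq_nonneg _) s9.le
  refine ⟨by rw [goal1, s7]; exact mul_nonneg hη.le (by linarith), ?_⟩
  intro hz
  rw [goal1] at hz
  have hz : ∑ u ∈ D.S, n u * g u = 0 := (mul_eq_zero.1 hz).resolve_left hη.ne'
  have hLo0 : Lo = 0 := by
    have : Lo ^ 2 * ∑ u ∈ D.S, D.c v u * ζ (C.y u) = 0 := by linarith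
    have := (mul_eq_zero.1 this).resolve_right s9.ne'
    exact pow_eq_zero_iff (two_ne_zero) |>.1 this
  have hTz : ∀ u ∈ D.S, ∀ w ∈ D.S,
      D.W v u w * (q u - q w) ^ 2 * (ℓ (C.y u) * ℓ (C.y w)) = 0 := by
    have h1 : ∑ u ∈ D.S, ∑ w ∈ D.S,
      D.W v u w * (q u - q w) ^ 2 * (ℓ (C.y u) * ℓ (C.y w)) = 0 := by
      rw [← s8]; linarith
    intro u hu w hw
    have h2 := (Finset.sum_eq_zero_iff_of_nonneg
      (fun u _ => Finset.sum_nonneg fun w _ => hT u w)).1 h1 u hu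
    exact (Finset.sum_eq_zero_iff_of_nonneg (fun w _ => hT u w)).1 h2 w hw
  have hnl : ∀ u ∈ D.S, n u * ℓ (C.y u) = 0 := by
    intro u hu
    rw [hAn, hLo0, hAq, mul_zero, sub_zero, Finset.sum_mul]
    refine Finset.sum_eq_zero fun w hw => ?_
    have := hTz u hu w hw
    simp only [mul_eq_zero, pow_eq_zero_iff, ne_eq, OfNat.ofNat_ne_zero, not_false_eq_true] at this ⊢
    tauto
  have supp : ∀ u, n u ≠ 0 → u ∈ D.S ∧ (u = a ∨ u = b ∨ u = c) := by
    intro u hu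
    have : ∃ w, ({v, u, w} : Finset U) ∈ C.fs := by
      by_contra hno; push Not at hno; exact hu (D.Nzero _ _ _ hno)
    obtain ⟨w, hw⟩ := this
    have hS : u ∈ D.S := D.hS _ hw (by simp)
    exact ⟨hS, nb u w hw ((mul_eq_zero.1 (hnl u hS)).resolve_left hu)⟩
  have pick : ∀ t, t ∈ D.S → ∀ φ : E →ₗ[ℝ] ℝ, φ (C.y v) = 0 → φ (C.y t) = 1 →
      (∀ u, u ≠ t → (u = a ∨ u = b ∨ u = c) → φ (C.y u) = 0) → n t = 0 := by
    intro t ht φ f1 f2 f3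
    have h1 : ∑ u ∈ D.S, n u * φ (C.y u) = 0 := bal φ f1
    rw [Finset.sum_eq_single t, f2, mul_one] at h1
    · exact h1
    · intro u _ hut
      by_cases h0 : n u = 0
      · rw [h0, zero_mul]
      · rw [f3 u hut (supp u h0).2, mul_zero]
    · exact fun h => absurd ht h
  intro u
  by_contra hne
  obtain ⟨hS, hu⟩ := supp u hne
  apply hne
  rcases hu with rfl | rfl | rfl
  · obtain ⟨φ, p1, p2, p3, p4⟩ := dual 0 1 0 0
    refine pick _ hS φ p1 p2 ?_
    rintro w hw (rfl | rfl | rfl)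
    · exact absurd rfl hw
    · exact p3
    · exact p4
  · obtain ⟨φ, p1, p2, p3, p4⟩ := dual 0 0 1 0
    refine pick _ hS φ p1 p3 ?_
    rintro w hw (rfl | rfl | rfl)
    · exact p2
    · exact absurd rfl hw
    · exact p4
  · obtain ⟨φ, p1, p2, p3, p4⟩ := dual 0 0 0 1
    refine pick _ hS φ p1 p4 ?_
    rintro w hw (rfl | rfl | rfl)
    · exact p2
    · exact p3
    · exact absurd rfl hw

/-- all bendings vanish -/
lemma N_eq_zero [FiniteDimensional ℝ E] (D : WD C) (h4 : Module.finrank ℝ E = 4)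
    (M : U → E →ₗ[ℝ] ℝ)
    (hM : ∀ F ∈ C.fs, ∀ u ∈ F, ∀ v ∈ F, M u (C.y v) + M v (C.y u) = 0) (v u : U) :
    D.N (fun u => M u C.o) v u = 0 := by
  set r : U → ℝ := fun u => M u C.o with hr
  set η : E →ₗ[ℝ] ℝ := ∑ F ∈ C.fs, C.α F with hη
  have ηpos : ∀ F ∈ C.fs, ∀ v ∈ F, 0 < η (C.y v) := by
    intro F hF v hv
    rw [hη, LinearMap.sum_apply]
    obtain ⟨F', hF', hv', -⟩ := C.piv F hF v hv
    exact Finset.sum_pos' (fun G hG => C.αnn hG hF hv) ⟨F', hF', C.αp F' hF' F hF v hv hv'⟩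
  set T : U → ℝ := fun v => ∑ u ∈ D.S, D.N r v u *
      (η (C.y v) * M u C.o - M v C.o * η (C.y u)) with hT
  have hvz : ∀ v, (¬ ∃ a x, ({v, a, x} : Finset U) ∈ C.fs) → ∀ u, D.N r v u = 0 := by
    intro v hv u
    push Not at hv
    exact D.Nzero _ _ _ (fun w => hv u w)
  have Tnn : ∀ v, 0 ≤ T v := by
    intro v
    by_cases hv : ∃ a x, ({v, a, x} : Finset U) ∈ C.fs
    · obtain ⟨a, x, h⟩ := hv
      exact (D.local_pos h4 M hM h η (ηpos _ h v (by simp))).1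
    · simp [hT, hvz v hv]
  have Tsum : ∑ v ∈ D.S, T v = 0 := by
    have : ∑ v ∈ D.S, T v = - ∑ v ∈ D.S, T v := by
      have h1 : ∑ v ∈ D.S, T v = ∑ u ∈ D.S, ∑ v ∈ D.S, D.N r v u *
          (η (C.y v) * M u C.o - M v C.o * η (C.y u)) := Finset.sum_comm
      rw [h1, ← Finset.sum_neg_distrib]
      rw [← h1]
      refine Finset.sum_congr rfl fun u _ => ?_
      simp only [hT]
      rw [← Finset.sum_neg_distrib]
      refine Finset.sum_congr rfl fun v _ => ?_
      rw [D.Nsymm r v u]; ring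
    linarith
  by_cases hv : ∃ a x, ({v, a, x} : Finset U) ∈ C.fs
  · obtain ⟨a, x, h⟩ := hv
    have hS : v ∈ D.S := D.hS _ h (by simp)
    have h0 := (Finset.sum_eq_zero_iff_of_nonneg (fun v _ => Tnn v)).1 Tsum v hS
    exact (D.local_pos h4 M hM h η (ηpos _ h v (by simp))).2 h0 u
  · exact hvz v hv u

end WD

namespace Cx
variable {U E : Type*} [DecidableEq U] [AddCommGroup E] [Module ℝ E]

/-- core propagation step in dimension 4 -/
lemma core [FiniteDimensional ℝ E] (C : Cx U E) (h4 : Module.finrank ℝ E = 4)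
    (M : U → E →ₗ[ℝ] ℝ)
    (hM : ∀ F ∈ C.fs, ∀ u ∈ F, ∀ v ∈ F, M u (C.y v) + M v (C.y u) = 0)
    {F F' : Finset U} (hF : F ∈ C.fs) (hF' : F' ∈ C.fs) {w : U} (hw : w ∈ F)
    (hsub : F.erase w ⊆ F') (h0 : ∀ u ∈ F, M u = 0) : ∀ u ∈ F', M u = 0 := by
  obtain ⟨u, v, rfl⟩ := C.facet3 h4 hF hw
  obtain ⟨d1, d2, d3⟩ := C.distinct3 h4 hF
  have hu' : u ∈ F' := hsub (by simp [d1.symm])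
  have hv' : v ∈ F' := hsub (by simp [d2.symm])
  by_cases hww : w ∈ F'
  · have : ({w, u, v} : Finset U) = F' := by
      apply C.facet_eq hF hF'
      intro z hz
      simp only [Finset.mem_insert, Finset.mem_singleton] at hz
      rcases hz with rfl | rfl | rfl <;> assumption
    rw [← this]; exact h0
  have hcard : F'.card = 3 := by have := C.crd _ hF'; omega
  have : ∃ w', w' ∉ ({u, v} : Finset U) ∧ F' = {u, v, w'} := by
    have h2 : ((F'.erase u).erase v).card = 1 := by
      rw [Finset.card_erase_of_mem (by simp [d3.symm, hv']), Finset.card_erase_of_mem hu']; omega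
    obtain ⟨w', hw'⟩ := Finset.card_eq_one.1 h2
    have hm : w' ∈ (F'.erase u).erase v := by rw [hw']; simp
    refine ⟨w', by simp at hm ⊢; tauto, ?_⟩
    rw [← Finset.insert_erase hu', ← Finset.insert_erase (show v ∈ F'.erase u by
      simp [d3.symm, hv']), hw']
  obtain ⟨w', hw', rfl⟩ := this
  have hFF : ({u, v, w} : Finset U) ∈ C.fs := by
    have : ({u, v, w} : Finset U) = {w, u, v} := by ext; simp; tauto
    rw [this]; exact hF
  obtain ⟨W, p, c, W1, W2, W3, W4, cpos, rel, zer⟩ := C.exists_W h4 (C.fs.biUnion id)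
    (fun F hF => Finset.subset_biUnion_of_mem id hF)
  let D : WD C := ⟨_, fun F hF => Finset.subset_biUnion_of_mem id hF, W, p, c, W1, W2, W3, W4,
    cpos, rel, zer⟩
  have hN := D.N_eq_zero h4 M hM u v
  have mu : M u = 0 := h0 u (by simp)
  have mv : M v = 0 := h0 v (by simp)
  have mw : M w = 0 := h0 w (by simp)
  have hr : M w' C.o = 0 := by
    obtain ⟨w2, e1, e2, huniq⟩ := C.third h4 hFF
    have ew : w' = w2 := by
      rcases huniq w' hF' with h | h
      · subst h; simp at hww
      · exact h
    subst ew
    unfold WD.N at hN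
    simp only [mu, mv, LinearMap.zero_apply, mul_zero, add_zero, zero_sub, neg_eq_zero] at hN
    rw [Finset.sum_eq_single w'] at hN
    · exact (mul_eq_zero.1 hN).resolve_left (D.W3 _ _ _ hF').ne'
    · intro z _ hz
      by_cases hF3 : ({u, v, z} : Finset U) ∈ C.fs
      · rcases huniq z hF3 with h | h
        · rw [h, mw]; simp
        · exact absurd h hz
      · rw [D.W4 _ _ _ hF3, zero_mul]
    · intro hns
      exact absurd (D.hS _ hF' (by simp)) hns
  have mw' : M w' = 0 := by
    ext z
    obtain ⟨x1, x2, x3, hz⟩ := C.expand3 h4 hF' z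
    have e1 : M w' (C.y u) = 0 := by
      have := hM _ hF' w' (by simp) u (by simp); rw [mu] at this; simpa using this
    have e2 : M w' (C.y v) = 0 := by
      have := hM _ hF' w' (by simp) v (by simp); rw [mv] at this; simpa using this
    have e3 : M w' (C.y w') = 0 := by
      have := hM _ hF' w' (by simp) w' (by simp); linarith
    rw [hz]; simp [e1, e2, e3, hr]
  intro z hz
  simp only [Finset.mem_insert, Finset.mem_singleton] at hz
  rcases hz with rfl | rfl | rfl <;> assumption

end Cx

/-- descend a functional to a quotient (zero when impossible) -/
def descQ {E : Type*} [AddCommGroup E] [Module ℝ E] (K : Submodule ℝ E) (f : E →ₗ[ℝ] ℝ) :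
    (E ⧸ K) →ₗ[ℝ] ℝ :=
  if h : K ≤ LinearMap.ker f then K.liftQ f h else 0

lemma descQ_mk {E : Type*} [AddCommGroup E] [Module ℝ E] {K : Submodule ℝ E} {f : E →ₗ[ℝ] ℝ}
    (h : K ≤ LinearMap.ker f) (x : E) : descQ K f (Submodule.Quotient.mk x) = f x := by
  rw [descQ, dif_pos h, Submodule.liftQ_apply]

namespace Cx
variable {U E : Type*} [DecidableEq U] [AddCommGroup E] [Module ℝ E]

/-- span of a face -/
def spn (C : Cx U E) (σ : Finset U) : Submodule ℝ E := Submodule.span ℝ (C.y '' (σ : Set U))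

lemma spn_le (C : Cx U E) {σ : Finset U} {f : E →ₗ[ℝ] ℝ} (h : ∀ s ∈ σ, f (C.y s) = 0) :
    C.spn σ ≤ LinearMap.ker f := by
  rw [spn, Submodule.span_le]
  rintro _ ⟨u, hu, rfl⟩
  exact h u hu

/-- link complex -/
def link [FiniteDimensional ℝ E] (C : Cx U E) (σ : Finset U) : Cx U (E ⧸ C.spn σ) where
  y u := Submodule.Quotient.mk (C.y u)
  o := Submodule.Quotient.mk C.o
  fs := (C.fs.filter (fun F => σ ⊆ F)).image (fun F => F \ σ)
  α F := descQ (C.spn σ) (C.α (F ∪ σ))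
  αo := by
    intro F hF
    simp only [Finset.mem_image, Finset.mem_filter] at hF
    obtain ⟨G, ⟨hG, hs⟩, rfl⟩ := hF
    rw [Finset.sdiff_union_of_subset hs, descQ_mk (C.spn_le fun s h => C.αz G hG s (hs h)),
      C.αo G hG]
  αz := by
    intro F hF u hu
    simp only [Finset.mem_image, Finset.mem_filter] at hF
    obtain ⟨G, ⟨hG, hs⟩, rfl⟩ := hF
    rw [Finset.sdiff_union_of_subset hs, descQ_mk (C.spn_le fun s h => C.αz G hG s (hs h)),
      C.αz G hG u (Finset.mem_sdiff.1 hu).1]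
  αp := by
    intro F hF F' hF' u hu hu'
    simp only [Finset.mem_image, Finset.mem_filter] at hF hF'
    obtain ⟨G, ⟨hG, hs⟩, rfl⟩ := hF
    obtain ⟨G', ⟨hG', hs'⟩, rfl⟩ := hF'
    rw [Finset.sdiff_union_of_subset hs, descQ_mk (C.spn_le fun s h => C.αz G hG s (hs h))]
    simp only [Finset.mem_sdiff] at hu hu'
    exact C.αp G hG G' hG' u hu.1 (by tauto)
  ind := by
    intro F hF
    simp only [Finset.mem_image, Finset.mem_filter] at hF
    obtain ⟨G, ⟨hG, hs⟩, rfl⟩ := hF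
    rw [linearIndepOn_finset_iff]
    intro g hg u hu
    obtain ⟨L, hL, -⟩ := C.func hG (fun w => if w = u then 1 else 0) 0
    have hK : C.spn σ ≤ LinearMap.ker L := C.spn_le fun s h => by
      rw [hL s (hs h), if_neg]
      rintro rfl
      exact (Finset.mem_sdiff.1 hu).2 h
    have := congrArg (descQ _ L) hg
    rw [map_sum, map_zero, Finset.sum_eq_single u] at this
    · rw [map_smul, descQ_mk hK, hL u (Finset.mem_sdiff.1 hu).1] at this
      simpa using this
    · intro w hw hne
      rw [map_smul, descQ_mk hK, hL w (Finset.mem_sdiff.1 hw).1, if_neg hne]; simp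
    · exact fun h => absurd hu h
  crd := by
    intro F hF
    simp only [Finset.mem_image, Finset.mem_filter] at hF
    obtain ⟨G, ⟨hG, hs⟩, rfl⟩ := hF
    have h1 := Submodule.finrank_quotient_add_finrank (C.spn σ)
    have h2 : Module.finrank ℝ (C.spn σ) = σ.card := by
      have h := (C.ind G hG).mono (show (σ : Set U) ⊆ G from by exact_mod_cast hs)
      have := finrank_span_eq_card (R := ℝ) h
      rw [spn, Set.image_eq_range]
      simpa using this
    have h3 := C.crd G hG
    have h4 := Finset.card_sdiff_add_card_eq_card hs
    omega
  piv := by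
    intro F hF u hu
    simp only [Finset.mem_image, Finset.mem_filter] at hF
    obtain ⟨G, ⟨hG, hs⟩, rfl⟩ := hF
    rw [Finset.mem_sdiff] at hu
    obtain ⟨F', hF', h1, h2⟩ := C.piv G hG u hu.1
    have hs' : σ ⊆ F' := fun s h => h2 (Finset.mem_erase.2 ⟨by rintro rfl; exact hu.2 h, hs h⟩)
    refine ⟨F' \ σ, ?_, by simp [h1], ?_⟩
    · simp only [Finset.mem_image, Finset.mem_filter]
      exact ⟨F', ⟨hF', hs'⟩, rfl⟩
    · intro w hw
      simp only [Finset.mem_erase, Finset.mem_sdiff] at hw ⊢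
      exact ⟨h2 (Finset.mem_erase.2 ⟨hw.1, hw.2.1⟩), hw.2.2⟩

lemma mem_link [FiniteDimensional ℝ E] (C : Cx U E) {σ F : Finset U} (hF : F ∈ C.fs)
    (hs : σ ⊆ F) : F \ σ ∈ (C.link σ).fs := by
  simp only [link, Finset.mem_image, Finset.mem_filter]
  exact ⟨F, ⟨hF, hs⟩, rfl⟩

lemma adj_step [FiniteDimensional ℝ E] (C : Cx U E) (σ : Finset U)
    (h4 : Module.finrank ℝ E = σ.card + 4) (M : U → E →ₗ[ℝ] ℝ)
    (hM : ∀ F ∈ C.fs, σ ⊆ F → ∀ u ∈ F, ∀ v ∈ F, M u (C.y v) + M v (C.y u) = 0)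
    {F F' : Finset U} (hF : F ∈ C.fs) (hF' : F' ∈ C.fs) (hs : σ ⊆ F) (hs' : σ ⊆ F') {w : U}
    (hw : w ∈ F) (hwF' : w ∉ F') (hsub : F.erase w ⊆ F') (h0 : ∀ u ∈ F, M u = 0) :
    ∀ u ∈ F', M u = 0 := by
  have hK : ∀ G ∈ C.fs, σ ⊆ G → ∀ u ∈ G, C.spn σ ≤ LinearMap.ker (M u) := by
    intro G hG hsG u hu
    apply C.spn_le
    intro s h
    have := hM G hG hsG u hu s (hsG h)
    rw [h0 s (hs h)] at this
    simpa using this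
  have hfr : Module.finrank ℝ (E ⧸ C.spn σ) = 4 := by
    have h1 := (C.link σ).crd _ (C.mem_link hF hs)
    have h3 := C.crd F hF
    have h4 := Finset.card_sdiff_add_card_eq_card hs
    omega
  have key := (C.link σ).core hfr (fun u => descQ (C.spn σ) (M u)) ?_ (C.mem_link hF hs)
    (C.mem_link hF' hs') (w := w) (Finset.mem_sdiff.2 ⟨hw, fun h => hwF' (hs' h)⟩) ?_ ?_
  · intro u hu
    by_cases hus : u ∈ σ
    · exact h0 u (hs hus)
    · have := key u (Finset.mem_sdiff.2 ⟨hu, hus⟩)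
      ext z
      rw [← descQ_mk (hK F' hF' hs' u hu) z, this]
      rfl
  · intro G hG u hu v hv
    simp only [link, Finset.mem_image, Finset.mem_filter] at hG
    obtain ⟨G, ⟨hG, hsG⟩, rfl⟩ := hG
    rw [Finset.mem_sdiff] at hu hv
    simp only [link]
    rw [descQ_mk (hK G hG hsG u hu.1), descQ_mk (hK G hG hsG v hv.1)]
    exact hM G hG hsG u hu.1 v hv.1
  · intro z hz
    simp only [Finset.mem_erase, Finset.mem_sdiff] at hz ⊢
    exact ⟨hsub (Finset.mem_erase.2 ⟨hz.1, hz.2.1⟩), hz.2.2⟩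
  · intro u hu
    rw [Finset.mem_sdiff] at hu
    ext z
    simp [h0 u hu.1, descQ]

/-- infinitesimal rigidity of stars -/
theorem rigid [FiniteDimensional ℝ E] (C : Cx U E) (σ : Finset U)
    (h4 : σ.card + 4 ≤ Module.finrank ℝ E) (M : U → E →ₗ[ℝ] ℝ)
    (hM : ∀ F ∈ C.fs, σ ⊆ F → ∀ u ∈ F, ∀ v ∈ F, M u (C.y v) + M v (C.y u) = 0)
    {F0 : Finset U} (hF0 : F0 ∈ C.fs) (hs0 : σ ⊆ F0) :
    ∃ B : E →ₗ[ℝ] E →ₗ[ℝ] ℝ, (∀ x z, B x z + B z x = 0) ∧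
      ∀ F ∈ C.fs, σ ⊆ F → ∀ u ∈ F, M u = B (C.y u) := by
  have hd : ∀ i, ∃ ξ : E →ₗ[ℝ] ℝ, ∀ j ∈ F0, ξ (C.y j) = if i = j then 1 else 0 := fun i =>
    let ⟨L, hL, _⟩ := C.func hF0 (fun j => if i = j then 1 else 0) 0
    ⟨L, hL⟩
  choose ξ hξ using hd
  obtain ⟨B, hB, hB0⟩ := ext_alt F0 C.y M ξ (fun i _ j hj => by
    rw [hξ i j hj]; congr) (hM F0 hF0 hs0)
  refine ⟨B, hB, ?_⟩
  refine C.conn σ F0 hF0 hs0 (fun F => ∀ u ∈ F, M u = B (C.y u)) (fun u hu => (hB0 u hu).symm) ?_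
  intro F hF F' hF' hs hs' w hw hwF' hsub hQ
  have hsw : σ ⊆ F.erase w := fun s h => Finset.mem_erase.2
    ⟨by rintro rfl; exact hwF' (hs' h), hs h⟩
  have hc := C.crd F hF
  have hce := Finset.card_erase_of_mem hw
  obtain ⟨σ', h1, h2, h3⟩ := Finset.exists_subsuperset_card_eq hsw
    (n := Module.finrank ℝ E - 4) (by omega) (by omega)
  have := C.adj_step σ' (by omega) (fun u => M u - B (C.y u)) ?_ hF hF'
    (h2.trans (Finset.erase_subset _ _)) (h2.trans hsub) hw hwF' hsub ?_
  · intro u hu; exact sub_eq_zero.1 (this u hu)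
  · intro G hG hsG u hu v hv
    have e1 := hM G hG (h1.trans hsG) u hu v hv
    have e2 := hB (C.y u) (C.y v)
    simp only [LinearMap.sub_apply]
    linarith
  · intro u hu; exact sub_eq_zero.2 (hQ u hu)

end Cx

section poly
variable {d : ℕ}

/-- supporting functional (right-hand side 1) -/
def Supp (P : SPolytope d) (a : (Fin d → ℝ) →ₗ[ℝ] ℝ) : Prop := ∀ v ∈ P.V, a v ≤ 1

/-- tight vertices -/
def tight (P : SPolytope d) (a : (Fin d → ℝ) →ₗ[ℝ] ℝ) : Finset (Fin d → ℝ) :=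
  P.V.filter (fun v => a v = 1)

lemma mem_tight {P : SPolytope d} {a : (Fin d → ℝ) →ₗ[ℝ] ℝ} {v : Fin d → ℝ} :
    v ∈ tight P a ↔ v ∈ P.V ∧ a v = 1 := by
  simp [tight]

lemma V_nonempty (P : SPolytope d) : P.V.Nonempty := by
  by_contra h
  rw [Finset.not_nonempty_iff_eq_empty] at h
  have := P.span_top
  rw [h] at this
  simp at this

lemma body_le {P : SPolytope d} {a : (Fin d → ℝ) →ₗ[ℝ] ℝ} {c : ℝ} (h : ∀ v ∈ P.V, a v ≤ c) :
    ∀ y ∈ polyBody P.V, a y ≤ c := by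
  intro y hy
  have : polyBody P.V ⊆ {y | a y ≤ c} := by
    apply convexHull_min
    · intro v hv; exact h v hv
    · exact convex_halfSpace_le a.isLinear c
  exact this hy

lemma proper_of_supp {P : SPolytope d} (hcs : IsCS P) {a : (Fin d → ℝ) →ₗ[ℝ] ℝ} (h : Supp P a) :
    IsProperFace P.V {y ∈ polyBody P.V | a y = 1} := by
  refine ⟨⟨a, 1, body_le h, rfl⟩, ?_⟩
  intro he
  obtain ⟨v, hv⟩ := V_nonempty P
  have h1 : v ∈ {y ∈ polyBody P.V | a y = 1} := by
    rw [he]; exact subset_convexHull ℝ _ hv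
  have h2 : -v ∈ {y ∈ polyBody P.V | a y = 1} := by
    rw [he]; exact subset_convexHull ℝ _ (hcs v hv)
  have e1 := h1.2
  have e2 := h2.2
  rw [map_neg] at e2
  linarith

lemma bface_iff {P : SPolytope d} (hcs : IsCS P) (s : Finset (Fin d → ℝ)) :
    BFace P s ↔ ∃ a, Supp P a ∧ s ⊆ tight P a := by
  constructor
  · rintro ⟨hs, F, ⟨⟨f, c, h1, rfl⟩, h2⟩, h3⟩
    have hle : ∀ v ∈ P.V, f v ≤ c := fun v hv => h1 v (subset_convexHull ℝ _ hv)
    have hc : 0 < c := by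
      by_contra hc
      push Not at hc
      have hz : ∀ v ∈ P.V, f v = 0 ∧ c = 0 := by
        intro v hv
        have e1 := hle v hv
        have e2 := hle (-v) (hcs v hv)
        rw [map_neg] at e2
        constructor <;> linarith
      obtain ⟨v, hv⟩ := V_nonempty P
      have c0 := (hz v hv).2
      apply h2
      ext y
      constructor
      · exact fun h => h.1
      · intro hy
        refine ⟨hy, ?_⟩
        have e1 := body_le (P := P) (a := f) (c := 0) (fun v hv => (hz v hv).1.le) y hy
        have e2 := body_le (P := P) (a := -f) (c := 0)
          (fun v hv => by simp [(hz v hv).1]) y hy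
        simp at e2
        linarith
    refine ⟨c⁻¹ • f, ?_, ?_⟩
    · intro v hv
      simp only [LinearMap.smul_apply, smul_eq_mul]
      rw [inv_mul_le_iff₀ hc]; simpa using hle v hv
    · intro v hv
      rw [mem_tight]
      refine ⟨hs hv, ?_⟩
      have := (h3 hv).2
      simp [this, hc.ne']
  · rintro ⟨a, ha, hs⟩
    refine ⟨fun v hv => (mem_tight.1 (hs hv)).1, _, proper_of_supp hcs ha, ?_⟩
    intro v hv
    have := mem_tight.1 (hs hv)
    exact ⟨subset_convexHull ℝ _ this.1, this.2⟩

lemma tight_ind {P : SPolytope d} (hcs : IsCS P) {a : (Fin d → ℝ) →ₗ[ℝ] ℝ} (h : Supp P a) :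
    LinearIndepOn ℝ id (tight P a : Set (Fin d → ℝ)) := by
  have h1 := (P.simplicial _ (proper_of_supp hcs h)).1
  have hset : ((P.V : Set (Fin d → ℝ)) ∩ {y ∈ polyBody P.V | a y = 1}) =
      (tight P a : Set (Fin d → ℝ)) := by
    ext v
    simp only [Set.mem_inter_iff, Finset.mem_coe, Set.mem_setOf_eq, mem_tight]
    constructor
    · rintro ⟨h1, h2, h3⟩; exact ⟨h1, h3⟩
    · rintro ⟨h1, h3⟩; exact ⟨h1, subset_convexHull ℝ _ h1, h3⟩
  rw [hset] at h1
  rw [linearIndepOn_finset_iff]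
  intro g hg u hu
  rw [affineIndependent_iff] at h1
  have hsum : ∑ v ∈ tight P a, g v = 0 := by
    have := congrArg a hg
    rw [map_sum, map_zero] at this
    rw [← this]
    refine Finset.sum_congr rfl fun v hv => ?_
    simp [(mem_tight.1 hv).2]
  have := h1 Finset.univ (fun x => g x) ?_ ?_ ⟨u, hu⟩ (Finset.mem_univ _)
  · exact this
  · rw [← hsum]; exact Finset.sum_coe_sort (tight P a) g
  · rw [← hg]; exact Finset.sum_coe_sort (tight P a) (fun v => g v • v)

lemma card_tight_le {P : SPolytope d} (hcs : IsCS P) {a : (Fin d → ℝ) →ₗ[ℝ] ℝ} (h : Supp P a) :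
    (tight P a).card ≤ d := by
  have := (tight_ind hcs h).fintype_card_le_finrank
  simpa using this

lemma exists_pos {P : SPolytope d} (hcs : IsCS P) {b : (Fin d → ℝ) →ₗ[ℝ] ℝ} (hb : b ≠ 0) :
    ∃ w ∈ P.V, 0 < b w := by
  by_contra hno
  push Not at hno
  have hz : ∀ v ∈ P.V, b v = 0 := by
    intro v hv
    have e1 := hno v hv
    have e2 := hno (-v) (hcs v hv)
    rw [map_neg] at e2
    linarith
  apply hb
  have hspan : Submodule.span ℝ (P.V : Set (Fin d → ℝ)) ≤ LinearMap.ker b := by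
    rw [Submodule.span_le]; intro v hv; exact hz v hv
  have htop : (⊤ : Submodule ℝ (Fin d → ℝ)) ≤ Submodule.span ℝ (P.V : Set (Fin d → ℝ)) := by
    intro x _
    have hx : x ∈ affineSpan ℝ (P.V : Set (Fin d → ℝ)) := by rw [P.span_top]; trivial
    exact affineSpan_le_toAffineSubspace_span hx
  ext1
  ext x
  exact hspan (htop trivial)

lemma rotate {P : SPolytope d} (hcs : IsCS P) {a b : (Fin d → ℝ) →ₗ[ℝ] ℝ} (h : Supp P a)
    (hb : b ≠ 0) (hab : ∀ v ∈ P.V, a v = 1 → b v ≤ 0) :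
    ∃ s : ℝ, 0 < s ∧ Supp P (a + s • b) ∧ ∃ w ∈ P.V, 0 < b w ∧ (a + s • b) w = 1 := by
  obtain ⟨w0, hw0, hbw0⟩ := exists_pos hcs hb
  obtain ⟨w, hw, hmin⟩ := Finset.exists_min_image (P.V.filter (fun v => 0 < b v))
    (fun v => (1 - a v) / b v) ⟨w0, Finset.mem_filter.2 ⟨hw0, hbw0⟩⟩
  obtain ⟨hwV, hbw⟩ := Finset.mem_filter.1 hw
  have haw : a w < 1 := by
    rcases lt_or_eq_of_le (h w hwV) with h1 | h1
    · exact h1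
    · linarith [hab w hwV h1]
  have hs : 0 < (1 - a w) / b w := div_pos (by linarith) hbw
  refine ⟨(1 - a w) / b w, hs, ?_, w, hwV, hbw, ?_⟩
  · intro v hv
    simp only [LinearMap.add_apply, LinearMap.smul_apply, smul_eq_mul]
    by_cases hbv : 0 < b v
    · have := hmin v (Finset.mem_filter.2 ⟨hv, hbv⟩)
      rw [le_div_iff₀ hbv] at this
      linarith
    · push Not at hbv
      have := h v hv
      have := mul_nonpos_of_nonneg_of_nonpos hs.le hbv
      linarith
  · simp only [LinearMap.add_apply, LinearMap.smul_apply, smul_eq_mul]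
    field_simp; ring

lemma extend_facet {P : SPolytope d} (hcs : IsCS P) : ∀ (k : ℕ) (a : (Fin d → ℝ) →ₗ[ℝ] ℝ),
    Supp P a → d ≤ (tight P a).card + k →
    ∃ a', Supp P a' ∧ tight P a ⊆ tight P a' ∧ (tight P a').card = d := by
  intro k
  induction k with
  | zero =>
    intro a ha hk
    exact ⟨a, ha, subset_rfl, le_antisymm (card_tight_le hcs ha) hk⟩
  | succ k ih =>
    intro a ha hk
    rcases (card_tight_le hcs ha).eq_or_lt with hc | hc
    · exact ⟨a, ha, subset_rfl, hc⟩
    · have hne : Submodule.span ℝ (tight P a : Set (Fin d → ℝ)) < ⊤ := by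
        rw [lt_top_iff_ne_top]
        intro htop
        have h1 := finrank_span_finset_le_card (R := ℝ) (tight P a)
        unfold Set.finrank at h1
        rw [htop, finrank_top] at h1
        simp at h1
        omega
      obtain ⟨b, hb, hker⟩ := Submodule.exists_le_ker_of_lt_top _ hne
      have hbz : ∀ v ∈ tight P a, b v = 0 := fun v hv => hker (Submodule.subset_span hv)
      obtain ⟨s, hs, hsupp, w, hw, hbw, hw1⟩ := rotate hcs ha hb
        (fun v hv h1 => (hbz v (mem_tight.2 ⟨hv, h1⟩)).le)
      have hsub : tight P a ⊆ tight P (a + s • b) := by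
        intro v hv
        have h2 := mem_tight.1 hv
        exact mem_tight.2 ⟨h2.1, by simp [h2.2, hbz v hv]⟩
      have hlt : (tight P a).card < (tight P (a + s • b)).card := by
        apply Finset.card_lt_card
        refine ⟨hsub, fun h => ?_⟩
        have := hbz w (h (mem_tight.2 ⟨hw, hw1⟩))
        linarith
      obtain ⟨a', h1, h2, h3⟩ := ih _ hsupp (by omega)
      exact ⟨a', h1, hsub.trans h2, h3⟩

lemma pivot_facet {P : SPolytope d} (hcs : IsCS P) {a : (Fin d → ℝ) →ₗ[ℝ] ℝ} (ha : Supp P a)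
    (hc : (tight P a).card = d) {u : Fin d → ℝ} (hu : u ∈ tight P a) :
    ∃ a', Supp P a' ∧ (tight P a').card = d ∧ u ∉ tight P a' ∧
      (tight P a).erase u ⊆ tight P a' := by
  have h := tight_ind hcs ha
  have h' : LinearIndependent ℝ (fun v : (tight P a : Set (Fin d → ℝ)) => id (v : Fin d → ℝ)) := h
  obtain ⟨b, hb⟩ := LinearMap.exists_extend ((Module.Basis.span h').constr ℝ
    (fun v : (tight P a : Set (Fin d → ℝ)) => if (v : Fin d → ℝ) = u then (-1 : ℝ) else 0))
  have key : ∀ v ∈ tight P a, b v = if v = u then -1 else 0 := by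
    intro v hv
    have := (Module.Basis.span h').constr_basis ℝ
      (fun v : (tight P a : Set (Fin d → ℝ)) => if (v : Fin d → ℝ) = u then (-1 : ℝ) else 0) ⟨v, hv⟩
    rw [← hb] at this
    simpa [Module.Basis.span_apply] using this
  have hbu : b u = -1 := by rw [key u hu, if_pos rfl]
  obtain ⟨s, hs, hsupp, w, hw, hbw, hw1⟩ := rotate hcs ha (b := b)
    (by rintro rfl; simp at hbu)
    (fun v hv h1 => by rw [key v (mem_tight.2 ⟨hv, h1⟩)]; split_ifs <;> norm_num)
  have hua : a u = 1 := (mem_tight.1 hu).2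
  have hnu : u ∉ tight P (a + s • b) := by
    intro h
    have := (mem_tight.1 h).2
    simp [hua, hbu] at this
    linarith
  have hsub : (tight P a).erase u ⊆ tight P (a + s • b) := by
    intro v hv
    obtain ⟨h1, h2⟩ := Finset.mem_erase.1 hv
    have h3 := mem_tight.1 h2
    refine mem_tight.2 ⟨h3.1, ?_⟩
    simp [h3.2, key v h2, h1]
  refine ⟨_, hsupp, ?_, hnu, hsub⟩
  apply le_antisymm (card_tight_le hcs hsupp)
  have hwn : w ∉ (tight P a).erase u := by
    intro h
    have := key w (Finset.mem_of_mem_erase h)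
    rw [this] at hbw
    split_ifs at hbw <;> linarith
  have h1 : insert w ((tight P a).erase u) ⊆ tight P (a + s • b) :=
    Finset.insert_subset (mem_tight.2 ⟨hw, hw1⟩) hsub
  have h2 := Finset.card_le_card h1
  rw [Finset.card_insert_of_notMem hwn, Finset.card_erase_of_mem hu] at h2
  have := Finset.card_pos.2 ⟨u, hu⟩
  omega

/-- facets -/
def facets (P : SPolytope d) : Finset (Finset (Fin d → ℝ)) :=
  P.V.powerset.filter (fun F => F.card = d ∧ ∃ a, Supp P a ∧ F = tight P a)

lemma mem_facets {P : SPolytope d} {F : Finset (Fin d → ℝ)} :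
    F ∈ facets P ↔ F.card = d ∧ ∃ a, Supp P a ∧ F = tight P a := by
  simp only [facets, Finset.mem_filter, Finset.mem_powerset, and_iff_right_iff_imp]
  rintro ⟨-, a, -, rfl⟩
  exact Finset.filter_subset _ _

/-- functional of a facet -/
def facFun (P : SPolytope d) (F : Finset (Fin d → ℝ)) : (Fin d → ℝ) →ₗ[ℝ] ℝ :=
  if h : ∃ a, Supp P a ∧ F = tight P a then h.choose else 0

lemma facFun_spec {P : SPolytope d} {F : Finset (Fin d → ℝ)} (hF : F ∈ facets P) :
    Supp P (facFun P F) ∧ F = tight P (facFun P F) := by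
  have h := (mem_facets.1 hF).2
  rw [facFun, dif_pos h]
  exact h.choose_spec

/-- homogenised boundary complex -/
def polyCx (P : SPolytope d) (hcs : IsCS P) : Cx (Fin d → ℝ) ((Fin d → ℝ) × ℝ) where
  y v := (v, 1)
  o := (0, 1)
  fs := facets P
  α F := LinearMap.snd ℝ _ _ - (facFun P F).comp (LinearMap.fst ℝ _ _)
  αo := by intro F hF; simp
  αz := by
    intro F hF u hu
    have h := (facFun_spec hF).2
    rw [h] at hu
    simp [(mem_tight.1 hu).2]
  αp := by
    intro F hF F' hF' u hu hu'
    obtain ⟨h1, h2⟩ := facFun_spec hF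
    have hV : u ∈ P.V := by
      rw [(facFun_spec hF').2] at hu; exact (mem_tight.1 hu).1
    have h3 : facFun P F u ≠ 1 := fun h => hu' (by rw [h2]; exact mem_tight.2 ⟨hV, h⟩)
    have := lt_of_le_of_ne (h1 u hV) h3
    simp
    exact this
  ind := by
    intro F hF
    obtain ⟨h1, h2⟩ := facFun_spec hF
    have h3 := tight_ind hcs h1
    rw [← h2] at h3
    exact LinearIndependent.of_comp (LinearMap.fst ℝ (Fin d → ℝ) ℝ) h3
  crd := by
    intro F hF
    simp [(mem_facets.1 hF).1]
  piv := by
    intro F hF u hu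
    obtain ⟨hc, a, ha, rfl⟩ := mem_facets.1 hF
    obtain ⟨a', h1, h2, h3, h4⟩ := pivot_facet hcs ha hc hu
    exact ⟨_, mem_facets.2 ⟨h2, a', h1, rfl⟩, h3, h4⟩

lemma bface_facet {P : SPolytope d} (hcs : IsCS P) {s : Finset (Fin d → ℝ)} :
    BFace P s ↔ ∃ F ∈ facets P, s ⊆ F := by
  rw [bface_iff hcs]
  constructor
  · rintro ⟨a, ha, hs⟩
    obtain ⟨a', h1, h2, h3⟩ := extend_facet hcs d a ha (by omega)
    exact ⟨_, mem_facets.2 ⟨h3, a', h1, rfl⟩, hs.trans h2⟩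
  · rintro ⟨F, hF, hs⟩
    obtain ⟨-, a, ha, rfl⟩ := mem_facets.1 hF
    exact ⟨a, ha, hs⟩

lemma bface_neg {P : SPolytope d} (hcs : IsCS P) {s : Finset (Fin d → ℝ)} (h : BFace P s) :
    BFace P (s.image (fun x => -x)) := by
  rw [bface_iff hcs] at h ⊢
  obtain ⟨a, ha, hs⟩ := h
  refine ⟨-a, ?_, ?_⟩
  · intro v hv
    have := ha (-v) (hcs v hv)
    simpa using this
  · intro v hv
    obtain ⟨w, hw, rfl⟩ := Finset.mem_image.1 hv
    have := mem_tight.1 (hs hw)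
    exact mem_tight.2 ⟨hcs _ this.1, by simp [this.2]⟩

lemma bface_mono {P : SPolytope d} {s t : Finset (Fin d → ℝ)} (h : BFace P t) (hs : s ⊆ t) :
    BFace P s := by
  obtain ⟨h1, F, h2, h3⟩ := h
  exact ⟨hs.trans h1, F, h2, fun x hx => h3 (hs hx)⟩

end poly

section poly
variable {d : ℕ}

lemma vertex_supp (hd : 1 ≤ d) {P : SPolytope d} (hcs : IsCS P) {v : Fin d → ℝ} (hv : v ∈ P.V) :
    ∃ a, Supp P a ∧ a v = 1 := by
  have hclosed : IsClosed (convexHull ℝ ((P.V.erase v : Finset (Fin d → ℝ)) : Set (Fin d → ℝ))) :=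
    (P.V.erase v).finite_toSet.isClosed_convexHull ℝ
  obtain ⟨f, s, h1, h2⟩ := geometric_hahn_banach_closed_point (convex_convexHull ℝ _) hclosed
    (P.extreme v hv)
  have hlt : ∀ w ∈ P.V, w ≠ v → f w < f v := fun w hw hne =>
    (h1 w (subset_convexHull ℝ _ (Finset.mem_coe.2 (Finset.mem_erase.2 ⟨hne, hw⟩)))).trans h2
  have hv0 : v ≠ 0 := by
    rintro rfl
    have hall : ∀ w ∈ P.V, w = 0 := by
      intro w hw
      by_contra hne
      have e1 := hlt w hw hne
      have e2 := hlt (-w) (hcs w hw) (by simpa using hne)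
      simp at e1 e2
      linarith
    have : Nonempty (Fin d) := ⟨⟨0, hd⟩⟩
    obtain ⟨w, hw, hpos⟩ := exists_pos hcs (b := LinearMap.proj (R := ℝ) (⟨0, hd⟩ : Fin d))
      (by
        intro h
        have := LinearMap.congr_fun h (fun _ => (1 : ℝ))
        simp at this)
    rw [hall w hw] at hpos
    simp at hpos
  have hvv : -v ≠ v := by
    intro h
    apply hv0
    ext i
    have := congrFun h i
    simp at this ⊢
    linarith
  have hpos : 0 < f v := by
    have := hlt (-v) (hcs v hv) hvv
    rw [map_neg] at this
    linarith
  refine ⟨(f v)⁻¹ • (f : (Fin d → ℝ) →ₗ[ℝ] ℝ), ?_, by simp [hpos.ne']⟩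
  intro w hw
  simp only [LinearMap.smul_apply, smul_eq_mul, ContinuousLinearMap.coe_coe]
  rw [inv_mul_le_iff₀ hpos, mul_one]
  by_cases h : w = v
  · rw [h]
  · exact (hlt w hw h).le

lemma vertex_ne_neg (hd : 1 ≤ d) {P : SPolytope d} (hcs : IsCS P) {v : Fin d → ℝ} (hv : v ∈ P.V) :
    -v ≠ v := by
  obtain ⟨a, -, h⟩ := vertex_supp hd hcs hv
  intro he
  have : a (-v) = 1 := by rw [he, h]
  rw [map_neg] at this
  linarith

lemma vertex_facet (hd : 1 ≤ d) {P : SPolytope d} (hcs : IsCS P) {v : Fin d → ℝ} (hv : v ∈ P.V) :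
    ∃ F ∈ facets P, v ∈ F := by
  obtain ⟨a, ha, h⟩ := vertex_supp hd hcs hv
  have : BFace P {v} := (bface_iff hcs _).2 ⟨a, ha, by
    intro w hw; rw [Finset.mem_singleton.1 hw]; exact mem_tight.2 ⟨hv, h⟩⟩
  obtain ⟨F, hF, hs⟩ := (bface_facet hcs).1 this
  exact ⟨F, hF, hs (by simp)⟩

lemma not_antipodal {P : SPolytope d} (hcs : IsCS P) {s : Finset (Fin d → ℝ)} (h : BFace P s)
    {v : Fin d → ℝ} (hv : v ∈ s) : -v ∉ s := by
  intro hn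
  obtain ⟨a, -, hs⟩ := (bface_iff hcs _).1 h
  have e1 := (mem_tight.1 (hs hv)).2
  have e2 := (mem_tight.1 (hs hn)).2
  rw [map_neg] at e2
  linarith

lemma half {X : Type*} (S : Finset X) (f : X → X) (h1 : ∀ x ∈ S, f x ∈ S)
    (h2 : ∀ x ∈ S, f (f x) = x) (h3 : ∀ x ∈ S, f x ≠ x) :
    ∃ T ⊆ S, S.card = 2 * T.card ∧ (∀ x ∈ S, x ∈ T ∨ f x ∈ T) ∧ ∀ x ∈ T, f x ∉ T := by
  let r := @WellOrderingRel X
  have asym : ∀ x y, r x y → ¬ r y x := fun x y h => asymm h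
  have tri : ∀ x y, r x y ∨ x = y ∨ r y x := fun x y => trichotomous_of r x y
  let T := S.filter (fun x => r x (f x))
  have hT : ∀ x, x ∈ T ↔ x ∈ S ∧ r x (f x) := fun x => by simp [T]
  have c3 : ∀ x ∈ S, x ∈ T ∨ f x ∈ T := by
    intro x hx
    rw [hT, hT, h2 x hx]
    rcases tri x (f x) with h | h | h
    · exact Or.inl ⟨hx, h⟩
    · exact absurd h.symm (h3 x hx)
    · exact Or.inr ⟨h1 x hx, h⟩
  have c4 : ∀ x ∈ T, f x ∉ T := by
    intro x hx hfx
    rw [hT] at hx hfx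
    rw [h2 x hx.1] at hfx
    exact asym _ _ hx.2 hfx.2
  refine ⟨T, Finset.filter_subset _ _, ?_, c3, c4⟩
  have hS : S = T ∪ T.image f := by
    ext x
    rw [Finset.mem_union, Finset.mem_image]
    constructor
    · intro hx
      rcases c3 x hx with h | h
      · exact Or.inl h
      · exact Or.inr ⟨f x, h, h2 x hx⟩
    · rintro (h | ⟨z, hz, rfl⟩)
      · exact ((hT _).1 h).1
      · exact h1 z ((hT _).1 hz).1
  have hdis : Disjoint T (T.image f) := by
    rw [Finset.disjoint_left]
    intro x hx hx'
    obtain ⟨z, hz, rfl⟩ := Finset.mem_image.1 hx'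
    exact c4 z hz hx
  have hinj : (T.image f).card = T.card := by
    apply Finset.card_image_of_injOn
    intro x hx z hz h
    rw [← h2 x ((hT _).1 hx).1, ← h2 z ((hT _).1 hz).1, h]
  have h5 : S.card = (T ∪ T.image f).card := congrArg _ hS
  rw [h5, Finset.card_union_of_disjoint hdis, hinj]; ring

/-- dot product as a linear map in the second variable -/
def dotL (x : Fin d → ℝ) : (Fin d → ℝ) →ₗ[ℝ] ℝ where
  toFun y := dotR x y
  map_add' y z := by simp [dotR, mul_add, Finset.sum_add_distrib]
  map_smul' c y := by simp [dotR, Finset.mul_sum]; exact Finset.sum_congr rfl fun i _ => by ring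

/-- dot product as a linear map in the first variable -/
def dotL' (y : Fin d → ℝ) : (Fin d → ℝ) →ₗ[ℝ] ℝ where
  toFun x := dotR x y
  map_add' y z := by simp [dotR, add_mul, Finset.sum_add_distrib]
  map_smul' c y := by simp [dotR, Finset.mul_sum]; exact Finset.sum_congr rfl fun i _ => by ring

lemma dotR_sub_left (x y z : Fin d → ℝ) : dotR (x - y) z = dotR x z - dotR y z :=
  map_sub (dotL' z) x y
lemma dotR_sub_right (x y z : Fin d → ℝ) : dotR x (y - z) = dotR x y - dotR x z :=
  map_sub (dotL x) y z
lemma dotR_neg_left (x z : Fin d → ℝ) : dotR (-x) z = - dotR x z :=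
  map_neg (dotL' z) x
lemma dotR_zero_right (x : Fin d → ℝ) : dotR x 0 = 0 :=
  map_zero (dotL x)
lemma dotR_single (i : Fin d) (z : Fin d → ℝ) : dotR (Pi.single i 1) z = z i := by
  simp [dotR, Pi.single_apply]

/-- affine functional of a velocity -/
def velF (v m : Fin d → ℝ) : ((Fin d → ℝ) × ℝ) →ₗ[ℝ] ℝ :=
  (dotL' m).comp (LinearMap.fst ℝ _ _) - (dotR v m) • LinearMap.snd ℝ _ _

lemma velF_apply (v m x : Fin d → ℝ) (t : ℝ) : velF v m (x, t) = dotR x m - dotR v m * t := by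
  simp [velF]; rfl

/-- rigidity of the star of `σ` -/
lemma star_rigid {P : SPolytope d} (hcs : IsCS P) (σ : Finset (Fin d → ℝ))
    (hσ : BFace P σ) (hc : σ.card + 3 ≤ d) (m : (Fin d → ℝ) → (Fin d → ℝ))
    (hm : ∀ u v, u ≠ v → BFace P ({u, v} ∪ σ) → dotR (u - v) (m u - m v) = 0) :
    ∃ B : ((Fin d → ℝ) × ℝ) →ₗ[ℝ] ((Fin d → ℝ) × ℝ) →ₗ[ℝ] ℝ, (∀ x z, B x z + B z x = 0) ∧
      ∀ u, BFace P (insert u σ) → velF u (m u) = B (u, 1) := by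
  obtain ⟨F0, hF0, hs0⟩ := (bface_facet hcs).1 hσ
  obtain ⟨B, hB, h⟩ := (polyCx P hcs).rigid σ (by simp; omega) (fun u => velF u (m u))
    (fun F hF hs u hu v hv => by
      have hF' : F ∈ facets P := hF
      show velF u (m u) (v, 1) + velF v (m v) (u, 1) = 0
      rw [velF_apply, velF_apply]
      by_cases huv : u = v
      · rw [huv]; ring
      · have := hm u v huv ((bface_facet hcs).2 ⟨F, hF', by
          intro z hz
          simp only [Finset.mem_union, Finset.mem_insert, Finset.mem_singleton] at hz
          rcases hz with (rfl | rfl) | hz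
          · exact hu
          · exact hv
          · exact hs hz⟩)
        simp only [dotR_sub_left, dotR_sub_right] at this
        linarith) (F0 := F0) hF0 hs0
  refine ⟨B, hB, fun u hu => ?_⟩
  obtain ⟨F, hF, hs⟩ := (bface_facet hcs).1 hu
  exact h F hF ((Finset.subset_insert _ _).trans hs) u (hs (by simp))

/-- even motions are translations -/
lemma even_motion (hd : 4 ≤ d) {P : SPolytope d} (hcs : IsCS P)
    (m : (Fin d → ℝ) → (Fin d → ℝ)) (hev : ∀ v ∈ P.V, m (-v) = m v)
    (hm : ∀ u v, u ≠ v → BFace P {u, v} → dotR (u - v) (m u - m v) = 0) :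
    ∃ b, ∀ v ∈ P.V, m v = b := by
  have hbot : BFace P ∅ := by
    obtain ⟨v, hv⟩ := V_nonempty P
    obtain ⟨F, hF, -⟩ := vertex_facet (by omega) hcs hv
    exact (bface_facet hcs).2 ⟨F, hF, Finset.empty_subset _⟩
  obtain ⟨B, hB, h⟩ := star_rigid hcs ∅ hbot (by simp; omega) m
    (fun u v huv hf => hm u v huv (by simpa using hf))
  have hv1 : ∀ v ∈ P.V, velF v (m v) = B (v, 1) := by
    intro v hv
    apply h
    obtain ⟨F, hF, hvF⟩ := vertex_facet (by omega) hcs hv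
    exact (bface_facet hcs).2 ⟨F, hF, by simpa using hvF⟩
  refine ⟨fun i => B (0, 1) (Pi.single i 1, 0), fun v hv => ?_⟩
  ext i
  have e1 := LinearMap.congr_fun (hv1 v hv) (Pi.single i 1, 0)
  have e2 := LinearMap.congr_fun (hv1 (-v) (hcs v hv)) (Pi.single i 1, 0)
  rw [velF_apply, dotR_single] at e1 e2
  rw [hev v hv] at e2
  have e3 : B (v, 1) (Pi.single i 1, 0) + B (-v, 1) (Pi.single i 1, 0) =
      2 * B (0, 1) (Pi.single i 1, 0) := by
    rw [← LinearMap.add_apply, ← map_add]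
    have : ((v, 1) + (-v, 1) : (Fin d → ℝ) × ℝ) = (2 : ℝ) • (0, 1) := by
      ext <;> simp; norm_num
    rw [this]; simp only [map_smul, LinearMap.smul_apply, smul_eq_mul]
  linarith

end poly

section poly
variable {d : ℕ}

/-- edge strain -/
def strain (m : (Fin d → ℝ) → (Fin d → ℝ)) (e : Finset (Fin d → ℝ)) : ℝ :=
  ∑ u ∈ e, ∑ v ∈ e, dotR (u - v) (m u - m v)

lemma strain_pair (m : (Fin d → ℝ) → (Fin d → ℝ)) {u v : Fin d → ℝ} (h : u ≠ v) :
    strain m {u, v} = 2 * dotR (u - v) (m u - m v) := by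
  rw [strain, Finset.sum_pair h, Finset.sum_pair h, Finset.sum_pair h]
  simp only [dotR_sub_left, dotR_sub_right]
  ring

lemma strain_neg {P : SPolytope d} (m : (Fin d → ℝ) → (Fin d → ℝ))
    (hev : ∀ v ∈ P.V, m (-v) = m v) {e : Finset (Fin d → ℝ)} (he : e ⊆ P.V) :
    strain m (e.image (fun x => -x)) = - strain m e := by
  have hinj : Set.InjOn (fun x : Fin d → ℝ => -x) e := fun x _ y _ h => neg_injective h
  rw [strain, strain, Finset.sum_image hinj, ← Finset.sum_neg_distrib]
  refine Finset.sum_congr rfl fun u hu => ?_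
  rw [Finset.sum_image hinj, ← Finset.sum_neg_distrib]
  refine Finset.sum_congr rfl fun v hv => ?_
  rw [hev u (he hu), hev v (he hv)]
  simp only [dotR_sub_left, dotR_neg_left]
  ring

lemma mem_edge {P : SPolytope d} {e : Finset (Fin d → ℝ)} :
    e ∈ edgeFinset P ↔ e.card = 2 ∧ BFace P e := by
  simp only [edgeFinset, Finset.mem_filter, Finset.mem_powerset, and_iff_right_iff_imp]
  exact fun h => h.2.1

/-- even extension of a velocity assignment -/
def evExt (T : Finset (Fin d → ℝ)) (v : Fin d → ℝ) : (T → (Fin d → ℝ)) →ₗ[ℝ] (Fin d → ℝ) :=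
  if h : v ∈ T then LinearMap.proj ⟨v, h⟩ else
    if h : -v ∈ T then LinearMap.proj ⟨-v, h⟩ else 0

/-- strain map -/
def strainMap (T : Finset (Fin d → ℝ)) (S : Finset (Finset (Fin d → ℝ))) :
    (T → (Fin d → ℝ)) →ₗ[ℝ] (S → ℝ) :=
  LinearMap.pi fun e => ∑ u ∈ e.1, ∑ v ∈ e.1, (dotL (u - v)).comp (evExt T u - evExt T v)

lemma strainMap_apply (T : Finset (Fin d → ℝ)) (S : Finset (Finset (Fin d → ℝ)))
    (m : T → (Fin d → ℝ)) (e : S) : strainMap T S m e = strain (fun v => evExt T v m) e := by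
  simp only [strainMap, strain, LinearMap.pi_apply, LinearMap.sum_apply, LinearMap.comp_apply,
    LinearMap.sub_apply]
  rfl

lemma exists_even (hd : 4 ≤ d) {P : SPolytope d} (hcs : IsCS P)
    (hg2 : g2 P = (d.choose 2 : ℤ) - (d : ℤ)) {e0 : Finset (Fin d → ℝ)} (he0 : e0 ∈ edgeFinset P) :
    ∃ m : (Fin d → ℝ) → (Fin d → ℝ), (∀ v ∈ P.V, m (-v) = m v) ∧ strain m e0 ≠ 0 ∧
      ∀ e ∈ edgeFinset P, e ≠ e0 → e ≠ e0.image (fun x => -x) → strain m e = 0 := by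
  have himg2 : ∀ e : Finset (Fin d → ℝ), (e.image (fun x => -x)).image (fun x => -x) = e := by
    intro e; rw [Finset.image_image]; simp
  obtain ⟨T, hTV, hTc, hT1, hT2⟩ := half P.V (fun v => -v) hcs (fun v _ => neg_neg v)
    (fun v hv => vertex_ne_neg (by omega) hcs hv)
  obtain ⟨S, hSE, hSc, hS1, hS2⟩ := half (edgeFinset P) (fun e => e.image (fun x => -x))
    (fun e he => by
      rw [mem_edge] at he ⊢
      refine ⟨?_, bface_neg hcs he.2⟩
      rw [Finset.card_image_of_injective _ neg_injective]; exact he.1)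
    (fun e _ => himg2 e)
    (fun e he h => by
      rw [mem_edge] at he
      have hne : e.Nonempty := Finset.card_pos.1 (by omega)
      obtain ⟨v, hv⟩ := hne
      apply not_antipodal hcs he.2 hv
      rw [← h]; exact Finset.mem_image_of_mem _ hv)
  have hev : ∀ m : T → (Fin d → ℝ), ∀ v ∈ P.V, evExt T (-v) m = evExt T v m := by
    intro m v hv
    rcases hT1 v hv with h | h
    · have h' := hT2 v h
      simp [evExt, h, h']
    · have h' := hT2 _ h
      simp only [neg_neg] at h'
      simp [evExt, h, h']
  have hext : ∀ m : T → (Fin d → ℝ), ∀ v : T, evExt T v m = m v := by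
    intro m v; simp [evExt]
  -- kernel
  have hker : Module.finrank ℝ (LinearMap.ker (strainMap T S)) ≤ d := by
    let K : (Fin d → ℝ) →ₗ[ℝ] (T → (Fin d → ℝ)) := LinearMap.pi fun _ => LinearMap.id
    have hle : LinearMap.ker (strainMap T S) ≤ LinearMap.range K := by
      intro m hm
      rw [LinearMap.mem_ker] at hm
      have hz : ∀ e ∈ S, strain (fun v => evExt T v m) e = 0 := by
        intro e he
        rw [← strainMap_apply T S m ⟨e, he⟩, hm]; rfl
      have hz' : ∀ e ∈ edgeFinset P, strain (fun v => evExt T v m) e = 0 := by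
        intro e he
        rcases hS1 e he with h | h
        · exact hz e h
        · have h1 := hz _ h
          rw [strain_neg (P := P) _ (hev m) (mem_edge.1 he).2.1] at h1
          linarith
      obtain ⟨b, hb⟩ := even_motion hd hcs (fun v => evExt T v m) (hev m) (fun u v huv hf => by
        have h1 := hz' {u, v} (mem_edge.2 ⟨Finset.card_pair huv, hf⟩)
        rw [strain_pair _ huv] at h1
        linarith)
      refine ⟨b, ?_⟩
      ext1 v
      rw [← hext m v, hb v (hTV v.2)]
      rfl
    have h1 := Submodule.finrank_mono hle
    have h2 := LinearMap.finrank_range_le K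
    simp at h2
    omega
  have hsurj : LinearMap.range (strainMap T S) = ⊤ := by
    apply Submodule.eq_top_of_finrank_eq
    apply le_antisymm (Submodule.finrank_le _)
    have h1 := LinearMap.finrank_range_add_finrank_ker (strainMap T S)
    have h2 : Module.finrank ℝ (T → (Fin d → ℝ)) = T.card * d := by
      rw [Module.finrank_pi_fintype]; simp
    have h3 : Module.finrank ℝ (S → ℝ) = S.card := by simp
    rw [h3]
    rw [h2] at h1
    have hcount : S.card + d = T.card * d := by
      unfold g2 f1 f0 at hg2
      have hch : (d + 1).choose 2 = d + d.choose 2 := by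
        rw [Nat.choose_succ_succ' d 1, Nat.choose_one_right]
      rw [hch, hTc, hSc] at hg2
      push_cast at hg2
      have : (S.card : ℤ) + d = T.card * d := by nlinarith
      exact_mod_cast this
    omega
  have key : ∀ ω : S → ℝ, ∃ m : T → (Fin d → ℝ), strainMap T S m = ω := by
    intro ω
    have : ω ∈ LinearMap.range (strainMap T S) := by rw [hsurj]; trivial
    exact this
  obtain ⟨m, hm⟩ := key (fun e => if e.1 = e0 ∨ e.1 = e0.image (fun x => -x) then 1 else 0)
  have hm' : ∀ e ∈ S, strain (fun v => evExt T v m) e =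
      if e = e0 ∨ e = e0.image (fun x => -x) then 1 else 0 := by
    intro e he
    rw [← strainMap_apply T S m ⟨e, he⟩, hm]
  have e0V := (mem_edge.1 he0).2.1
  refine ⟨fun v => evExt T v m, hev m, ?_, ?_⟩
  · rcases hS1 e0 he0 with h | h
    · rw [hm' _ h]; simp
    · have := hm' _ h
      rw [strain_neg (P := P) _ (hev m) e0V] at this
      simp at this
      intro h0
      rw [h0] at this
      norm_num at this
  · intro e he h1 h2
    rcases hS1 e he with h | h
    · rw [hm' _ h]; simp [h1, h2]
    · have := hm' _ h
      rw [strain_neg (P := P) _ (hev m) (mem_edge.1 he).2.1, if_neg] at this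
      · linarith
      · rintro (h3 | h3)
        · exact h2 (by rw [← h3, himg2])
        · exact h1 (by rw [← himg2 e, h3, himg2])

end poly

lemma main_face {d : ℕ} (hd : 4 ≤ d) {P : SPolytope d} (hcs : IsCS P)
    (hg2 : g2 P = (d.choose 2 : ℤ) - (d : ℤ)) {τ : Finset (Fin d → ℝ)}
    (hτ : IsMissingFace P τ) (h3 : 3 ≤ τ.card) (hub : τ.card ≤ d - 1) {e : Finset (Fin d → ℝ)}
    (he : e ⊆ τ) (hc : e.card = 2) : BFace P ((τ \ e) ∪ e.image (fun x => -x)) := by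
  by_contra hnot
  obtain ⟨hτV, hτn, hτs⟩ := hτ
  have hcs' := Finset.card_sdiff_add_card_eq_card he
  have heτ : e ≠ τ := by rintro rfl; omega
  have heF : BFace P e := hτs e ⟨he, fun h => heτ (Finset.Subset.antisymm he h)⟩
  have hσ : BFace P (τ \ e) := by
    apply hτs
    refine ⟨Finset.sdiff_subset, fun h => ?_⟩
    have := Finset.card_le_card h
    omega
  obtain ⟨m, -, hm0, hmz⟩ := exists_even hd hcs hg2 (mem_edge.2 ⟨hc, heF⟩)
  obtain ⟨B, hB, hst⟩ := star_rigid hcs (τ \ e) hσ (by omega) m (by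
    intro u v huv hf
    have hE : ({u, v} : Finset (Fin d → ℝ)) ∈ edgeFinset P :=
      mem_edge.2 ⟨Finset.card_pair huv, bface_mono hf Finset.subset_union_left⟩
    have h1 := hmz _ hE ?_ ?_
    · rw [strain_pair _ huv] at h1; linarith
    · intro h
      rw [h, Finset.union_sdiff_of_subset he] at hf
      exact hτn hf
    · intro h
      rw [h, Finset.union_comm] at hf
      exact hnot hf)
  obtain ⟨a, b, hab, rfl⟩ := Finset.card_eq_two.1 hc
  have hins : ∀ x z, ({a, b} : Finset (Fin d → ℝ)) = {x, z} → x ≠ z →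
      BFace P (insert x (τ \ {a, b})) := by
    intro x z hxz hne
    rw [hxz] at he ⊢
    apply hτs
    refine ⟨?_, fun h => ?_⟩
    · intro y hy
      rcases Finset.mem_insert.1 hy with rfl | hy
      · exact he (by simp)
      · exact (Finset.mem_sdiff.1 hy).1
    · have := h (he (show z ∈ ({x, z} : Finset (Fin d → ℝ)) by simp))
      simp [hne.symm] at this
  have ha := hst a (hins a b rfl hab)
  have hb := hst b (hins b a (Finset.pair_comm a b) hab.symm)
  apply hm0
  rw [strain_pair _ hab]
  have e1 := LinearMap.congr_fun ha (b, 1)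
  have e2 := LinearMap.congr_fun hb (a, 1)
  have e3 := hB (a, 1) (b, 1)
  rw [velF_apply] at e1 e2
  simp only [dotR_sub_left, dotR_sub_right]
  linarith

/-- Let `d ≥ 4` and let `P` be a cs simplicial `d`-polytope with
`g₂(P) = C(d,2) - d`. If `τ` is a missing face of `∂P` with `3 ≤ |τ| ≤ d - 1`, then for
every 2-element subset `e` of `τ`, the set `(τ \ e) ∪ (-e)` is a face of `∂P`; in
particular every pair `{u, w} ⊆ τ ∪ (-τ)` with `u ≠ w` and `w ≠ -u` is an edge of `∂P`. -/
theorem stmt12 {d : ℕ} (hd : 4 ≤ d) (P : SPolytope d) (hcs : IsCS P)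
    (hg2 : g2 P = (d.choose 2 : ℤ) - (d : ℤ)) (τ : Finset (Fin d → ℝ))
    (hτ : IsMissingFace P τ) (h3 : 3 ≤ τ.card) (hub : τ.card ≤ d - 1) :
    (∀ e ⊆ τ, e.card = 2 →
      BFace P ((τ \ e) ∪ e.image (fun x => -x))) ∧
    (∀ u ∈ τ ∪ τ.image (fun x => -x), ∀ w ∈ τ ∪ τ.image (fun x => -x),
      u ≠ w → w ≠ -u → BFace P {u, w}) := by
  have hmain : ∀ e ⊆ τ, e.card = 2 → BFace P ((τ \ e) ∪ e.image (fun x => -x)) :=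
    fun e he hc => main_face hd hcs hg2 hτ h3 hub he hc
  have hpp : ∀ u ∈ τ, ∀ w ∈ τ, u ≠ w → BFace P {u, w} := by
    intro u hu w hw hne
    apply hτ.2.2
    refine ⟨?_, fun h => ?_⟩
    · intro z hz
      simp only [Finset.mem_insert, Finset.mem_singleton] at hz
      rcases hz with rfl | rfl <;> assumption
    · have := Finset.card_le_card h
      rw [Finset.card_pair hne] at this
      omega
  have hpm : ∀ u ∈ τ, ∀ w ∈ τ, u ≠ w → BFace P {u, -w} := by
    intro u hu w hw hne
    have : ∃ z ∈ τ, z ∉ ({u, w} : Finset (Fin d → ℝ)) := by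
      by_contra hno
      push Not at hno
      have := Finset.card_le_card (show τ ⊆ {u, w} from hno)
      rw [Finset.card_pair hne] at this
      omega
    obtain ⟨z, hz, hzn⟩ := this
    simp only [Finset.mem_insert, Finset.mem_singleton, not_or] at hzn
    refine bface_mono (hmain {w, z} ?_ (Finset.card_pair (Ne.symm hzn.2))) ?_
    · intro y hy
      simp only [Finset.mem_insert, Finset.mem_singleton] at hy
      rcases hy with rfl | rfl <;> assumption
    · intro y hy
      simp only [Finset.mem_insert, Finset.mem_singleton] at hy
      rcases hy with rfl | rfl
      · refine Finset.mem_union_left _ (Finset.mem_sdiff.2 ⟨hu, ?_⟩)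
        simp [hne, Ne.symm hzn.1]
      · exact Finset.mem_union_right _ (Finset.mem_image_of_mem _ (by simp))
  refine ⟨hmain, ?_⟩
  intro u hu w hw hne hna
  rcases Finset.mem_union.1 hu with hu | hu <;> rcases Finset.mem_union.1 hw with hw | hw
  · exact hpp u hu w hw hne
  · obtain ⟨w, hw', rfl⟩ := Finset.mem_image.1 hw
    exact hpm u hu w hw' (fun h => hna (by rw [h]))
  · obtain ⟨u, hu', rfl⟩ := Finset.mem_image.1 hu
    rw [Finset.pair_comm]
    exact hpm w hw u hu' (fun h => hna (by simp [h]))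
  · obtain ⟨u, hu', rfl⟩ := Finset.mem_image.1 hu
    obtain ⟨w, hw', rfl⟩ := Finset.mem_image.1 hw
    have := bface_neg hcs (hpp u hu' w hw' (fun h => hne (by rw [h])))
    simpa [Finset.image_insert] using this
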